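/- arXiv:2404.10672 — 3 statements merged into one kernel-verified Lean document; each statement's English description precedes it below -/
import Mathlib

section
/- Let m ≥ 2 and ℓ = (ℓ_1,…,ℓ_m) ∈ ℤ_{>0}^m, and let G = G_{2ℓ} be the even multi-path graph. Then the minimal vectors of relint(ℝ₊(G)) ∩ ℤ^{V(G)} are exactly the m − 1 vectors α_k = Σ_{i=1}^{m} Σ_{j=1}^{2ℓ_i−1} ε_{u_{i,j}} + k·ε_{v1} + (m−k)·ε_{v2} for k = 1, …, m − 1. -/
open CategoryTheory MvPolynomial Finset
open scoped Classical

noncomputable section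

namespace Paper

/-- The monomial `x_u * x_v` associated to an unordered pair `{u, v}` of vertices. -/
def edgeMon (K : Type*) [CommRing K] {V : Type*} (e : Sym2 V) : MvPolynomial V K :=
  Sym2.lift ⟨fun u v => X u * X v, fun u v => mul_comm _ _⟩ e

/-- The `K`-algebra map `K[E(G)] → K[V(G)]` sending the variable of an edge `{u,v}` to
`x_u * x_v`. -/
def edgeHom (K : Type*) [CommRing K] {V : Type*} (G : SimpleGraph V) :
    MvPolynomial G.edgeSet K →ₐ[K] MvPolynomial V K :=
  aeval (fun e => edgeMon K (e : Sym2 V))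

/-- The toric ideal of a simple graph. -/
def toricIdeal (K : Type*) [CommRing K] {V : Type*} (G : SimpleGraph V) :
    Ideal (MvPolynomial G.edgeSet K) :=
  RingHom.ker (edgeHom K G).toRingHom

/-- The edge ring `K[G] = K[E(G)]/I_G`. -/
abbrev edgeRing (K : Type*) [CommRing K] {V : Type*} (G : SimpleGraph V) :=
  MvPolynomial G.edgeSet K ⧸ toricIdeal K G

open CategoryTheory.Limits in
/-- The projective dimension of a module, as an element of `ℕ∞`:  the least `n` such that `M`
admits a projective resolution vanishing in homological degrees `> n` (or `⊤` if there is
no such finite resolution). -/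
def projDim (R : Type*) [CommRing R] (M : ModuleCat R) : ℕ∞ :=
  sInf {n : ℕ∞ | ∃ m : ℕ, (m : ℕ∞) = n ∧
    ∃ P : ProjectiveResolution M, ∀ i : ℕ, m < i → IsZero (P.complex.X i)}

/-- The 0-1 vector `ε_u + ε_v` attached to an unordered pair `{u,v}` with `u ≠ v`. -/
def edgeVec {V : Type*} (e : Sym2 V) : V → ℝ :=
  fun v => if v ∈ e then 1 else 0

/-- The edge cone of a finite simple graph: all nonnegative real combinations of the vectors
`v_e = ε_u + ε_v`, for `e = {u,v}` an edge of `G`. -/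
def edgeCone {V : Type*} [Fintype V] (G : SimpleGraph V) : Set (V → ℝ) :=
  {x | ∃ a : Sym2 V → ℝ, (∀ e, 0 ≤ a e) ∧ (∀ e, e ∉ G.edgeSet → a e = 0) ∧
    x = ∑ e : Sym2 V, a e • edgeVec e}

/-- A vector has integer coordinates. -/
def IsIntegralVec {V : Type*} (x : V → ℝ) : Prop := ∀ v, ∃ n : ℤ, x v = n

/-- A minimal vector of `relint(ℝ₊(G)) ∩ ℤ^{V(G)}`. -/
def IsMinimalVec {V : Type*} [Fintype V] (G : SimpleGraph V) (x : V → ℝ) : Prop :=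
  x ∈ intrinsicInterior ℝ (edgeCone G) ∧ IsIntegralVec x ∧
    ¬ ∃ y z : V → ℝ, (y ∈ intrinsicInterior ℝ (edgeCone G) ∧ IsIntegralVec y) ∧
      (z ∈ edgeCone G ∧ IsIntegralVec z ∧ z ≠ 0) ∧ x = y + z

/-! ### Multi-path graphs.  `c i` is the number of interior vertices of the `i`-th path,
so the `i`-th path has length `c i + 1`. -/

/-- Vertices of the multi-path graph: `Sum.inl 0 = v1`, `Sum.inl 1 = v2`, and
`Sum.inr ⟨i, j⟩ = u_{i,j+1}`, the `(j+1)`-st interior vertex of the `i`-th path. -/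
abbrev MPV {m : ℕ} (c : Fin m → ℕ) : Type := Fin 2 ⊕ (Σ i : Fin m, Fin (c i))

def mpRel {m : ℕ} (c : Fin m → ℕ) : MPV c → MPV c → Prop
  | Sum.inl a, Sum.inr ⟨i, j⟩ => (a = 0 ∧ (j : ℕ) = 0) ∨ (a = 1 ∧ (j : ℕ) + 1 = c i)
  | Sum.inr ⟨i, j⟩, Sum.inr ⟨i', j'⟩ => (i : ℕ) = i' ∧ (j' : ℕ) = (j : ℕ) + 1
  | _, _ => False

/-- The multi-path graph with `m` paths, the `i`-th of which has `c i` interior vertices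
(hence length `c i + 1`), all starting at `v1 = Sum.inl 0` and ending at `v2 = Sum.inl 1`. -/
def multiPath {m : ℕ} (c : Fin m → ℕ) : SimpleGraph (MPV c) :=
  SimpleGraph.fromRel (mpRel c)

/-! ### The two-ear graph `G_m` and the one-ear graph `P_m`. -/

/-- Vertices of the two-ear graph:  `Sum.inl 0 = v1`, `Sum.inl 1 = v2`, `Sum.inl 2 = x1`,
`Sum.inl 3 = x2`, `Sum.inl 4 = y1`, `Sum.inl 5 = y2`, and `Sum.inr i = u_{i+1}`. -/
abbrev TEV (m : ℕ) : Type := Fin 6 ⊕ Fin (m - 1)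

def teRel (m : ℕ) : TEV m → TEV m → Prop
  | Sum.inl a, Sum.inl b =>
      (a = 0 ∧ b = 2) ∨ (a = 0 ∧ b = 3) ∨ (a = 2 ∧ b = 3) ∨ (a = 1 ∧ b = 4) ∨
      (a = 1 ∧ b = 5) ∨ (a = 4 ∧ b = 5) ∨ (a = 2 ∧ b = 4)
  | Sum.inl a, Sum.inr _ => a = 0 ∨ a = 1
  | _, _ => False

/-- The two-ear graph `𝐆_m`. -/
def twoEar (m : ℕ) : SimpleGraph (TEV m) := SimpleGraph.fromRel (teRel m)

/-- The one-ear graph `𝐏_m`, the induced subgraph of `𝐆_m` on the complement of `x2`. -/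
def oneEar (m : ℕ) : SimpleGraph ({v : TEV m | v ≠ Sum.inl 3} : Set (TEV m)) :=
  (twoEar m).induce {v : TEV m | v ≠ Sum.inl 3}

/-! ### Cycles, the odd-cycle condition, and compact graphs. -/

/-- The odd-cycle condition: any two vertex-disjoint odd cycles are joined by an edge. -/
def OddCycleCondition {V : Type*} (G : SimpleGraph V) : Prop :=
  ∀ (a b : V) (c₁ : G.Walk a a) (c₂ : G.Walk b b), c₁.IsCycle → c₂.IsCycle →
    Odd c₁.length → Odd c₂.length →
    (∀ x, x ∈ c₁.support → x ∉ c₂.support) →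
    ∃ x ∈ c₁.support, ∃ y ∈ c₂.support, G.Adj x y

/-- `G` has no even cycle. -/
def HasNoEvenCycle {V : Type*} (G : SimpleGraph V) : Prop :=
  ∀ (a : V) (c : G.Walk a a), c.IsCycle → ¬ Even c.length

/-- A compact graph: connected, all degrees at least `2`, no even cycle, and the
odd-cycle condition holds. -/
def IsCompactGraph {V : Type*} (G : SimpleGraph V) : Prop :=
  G.Connected ∧ (∀ v : V, 2 ≤ (G.neighborSet v).ncard) ∧ HasNoEvenCycle G ∧ OddCycleCondition G

/-- The number `t(G)` of minimal (= induced) cycles of `G`, counted via their vertex sets. -/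
def cycleCount {V : Type*} (G : SimpleGraph V) : ℕ :=
  Set.ncard {S : Set V | ∃ (a : V) (c : G.Walk a a), c.IsCycle ∧
    (∀ x y, x ∈ c.support → y ∈ c.support → G.Adj x y → s(x, y) ∈ c.edges) ∧
    S = {x | x ∈ c.support}}


/-! ### Relative interior of a finitely generated cone. -/

/-- The cone generated by a finite family. -/
def famCone {J E : Type*} [Fintype J] [AddCommGroup E] [Module ℝ E] (v : J → E) : Set E :=
  {x | ∃ b : J → ℝ, (∀ j, 0 ≤ b j) ∧ x = ∑ j, b j • v j}

theorem mem_relint_iff {E : Type*} [NormedAddCommGroup E] [NormedSpace ℝ E] (s : Set E) (x : E) :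
    x ∈ intrinsicInterior ℝ s ↔
      x ∈ s ∧ ∃ ε > 0, ∀ y ∈ affineSpan ℝ s, dist y x < ε → y ∈ s := by
  rw [mem_intrinsicInterior]
  constructor
  · rintro ⟨y, hy, rfl⟩
    refine ⟨(interior_subset (s := Set.preimage (Subtype.val : affineSpan ℝ s → E) s) hy : _), ?_⟩
    rw [mem_interior_iff_mem_nhds, Metric.mem_nhds_iff] at hy
    obtain ⟨ε, hε, h⟩ := hy
    exact ⟨ε, hε, fun z hz hd => h (show (⟨z, hz⟩ : affineSpan ℝ s) ∈ Metric.ball y ε from hd)⟩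
  · rintro ⟨hx, ε, hε, h⟩
    refine ⟨⟨x, subset_affineSpan ℝ s hx⟩, ?_, rfl⟩
    rw [mem_interior_iff_mem_nhds, Metric.mem_nhds_iff]
    exact ⟨ε, hε, fun z hz => h z z.2 hz⟩

theorem famCone_convex {J E : Type*} [Fintype J] [AddCommGroup E] [Module ℝ E] (v : J → E) :
    Convex ℝ (famCone v) := by
  rintro x ⟨b, hb, rfl⟩ y ⟨c, hc, rfl⟩ p q hp hq -
  refine ⟨fun j => p * b j + q * c j, fun j => ?_, ?_⟩
  · have := hb j
    have := hc j
    positivity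
  · simp only [Finset.smul_sum, ← Finset.sum_add_distrib, smul_smul, add_smul]

theorem mem_relint_famCone {J E : Type*} [Fintype J] [NormedAddCommGroup E] [NormedSpace ℝ E]
    [FiniteDimensional ℝ E] (v : J → E) (x : E) :
    x ∈ intrinsicInterior ℝ (famCone v) ↔ ∃ b : J → ℝ, (∀ j, 0 < b j) ∧ x = ∑ j, b j • v j := by
  constructor
  · intro h
    rw [mem_relint_iff] at h
    obtain ⟨hx, ε, hε, h⟩ := h
    set s : E := ∑ j, (1 : ℝ) • v j with hs
    have hsC : s ∈ famCone v := ⟨fun _ => 1, fun _ => zero_le_one, rfl⟩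
    obtain ⟨t, ht, htε⟩ : ∃ t : ℝ, 0 < t ∧ t * ‖x - s‖ < ε := by
      refine ⟨ε / (‖x - s‖ + 1), by positivity, ?_⟩
      rw [div_mul_eq_mul_div, div_lt_iff₀ (by positivity)]
      nlinarith [norm_nonneg (x - s)]
    have hmem : t • (x -ᵥ s) +ᵥ x ∈ affineSpan ℝ (famCone v) :=
      AffineSubspace.smul_vsub_vadd_mem _ t (subset_affineSpan ℝ _ hx)
        (subset_affineSpan ℝ _ hsC) (subset_affineSpan ℝ _ hx)
    have := h _ hmem (by
      simp only [vsub_eq_sub, vadd_eq_add, dist_eq_norm, add_sub_cancel_right, norm_smul]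
      rwa [Real.norm_of_nonneg ht.le])
    obtain ⟨b, hb, hbe⟩ := this
    refine ⟨fun j => (1 + t)⁻¹ * (b j + t), fun j => ?_, ?_⟩
    · have := hb j
      positivity
    · have h1 : (1 + t) • x = ∑ j, (b j + t) • v j := by
        simp only [add_smul, Finset.sum_add_distrib, ← hbe]
        rw [← Finset.smul_sum]
        simp only [hs, one_smul, vsub_eq_sub, vadd_eq_add, smul_sub]
        abel
      simp only [mul_smul, ← Finset.smul_sum, ← h1]
      rw [smul_smul, inv_mul_cancel₀ (by positivity), one_smul]
  · rintro ⟨b, hb, rfl⟩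
    have hne : (famCone v).Nonempty := ⟨_, fun _ => 1, fun _ => zero_le_one, rfl⟩
    obtain ⟨y, hy⟩ := hne.intrinsicInterior (famCone_convex v)
    rw [mem_relint_iff] at hy ⊢
    obtain ⟨hyC, ε, hε, h⟩ := hy
    have hxC : (∑ j, b j • v j) ∈ famCone v := ⟨b, fun j => (hb j).le, rfl⟩
    refine ⟨hxC, ?_⟩
    have hyC' := hyC
    obtain ⟨c, hc, hce⟩ := hyC'
    obtain ⟨t, ht, htb⟩ : ∃ t : ℝ, 0 < t ∧ ∀ j, t * c j ≤ b j := by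
      have : ∀ᶠ t : ℝ in nhdsWithin 0 (Set.Ioi 0), ∀ j, t * c j ≤ b j := by
        rw [Filter.eventually_all]
        intro j
        have hcont : Filter.Tendsto (fun t : ℝ => t * c j) (nhds 0) (nhds (0 * c j)) :=
          Continuous.tendsto (by fun_prop) 0
        rw [zero_mul] at hcont
        have := (hcont.eventually (eventually_lt_nhds (hb j)))
        exact (this.filter_mono nhdsWithin_le_nhds).mono fun _ h => h.le
      obtain ⟨t, h1, h2⟩ := (this.and self_mem_nhdsWithin).exists
      exact ⟨t, h2, h1⟩
    refine ⟨t * ε, by positivity, fun z hz hd => ?_⟩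
    have hmem : t⁻¹ • (z -ᵥ (∑ j, b j • v j)) +ᵥ y ∈ affineSpan ℝ (famCone v) :=
      AffineSubspace.smul_vsub_vadd_mem _ t⁻¹ hz
        (subset_affineSpan ℝ _ hxC) (subset_affineSpan ℝ _ hyC)
    have := h _ hmem (by
      simp only [vsub_eq_sub, vadd_eq_add, dist_eq_norm, add_sub_cancel_right, norm_smul] at hd ⊢
      rw [Real.norm_of_nonneg (by positivity), inv_mul_lt_iff₀ ht]
      exact hd)
    obtain ⟨w, hw, hwe⟩ := this
    refine ⟨fun j => t * w j + (b j - t * c j), fun j => ?_, ?_⟩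
    · have := htb j
      have := mul_nonneg ht.le (hw j)
      linarith
    · simp only [add_smul, sub_smul, mul_smul, Finset.sum_add_distrib, Finset.sum_sub_distrib,
        ← Finset.smul_sum, ← hwe, ← hce]
      simp only [vsub_eq_sub, vadd_eq_add, smul_add, smul_smul]
      rw [mul_inv_cancel₀ ht.ne', one_smul]
      abel

theorem edgeCone_eq_famCone {V J : Type*} [Fintype V] [Fintype J] (G : SimpleGraph V)
    (f : J → Sym2 V) (hf : Set.range f = G.edgeSet) :
    edgeCone G = famCone (fun j => edgeVec (f j)) := by
  ext x
  constructor
  · rintro ⟨a, ha, ha0, rfl⟩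
    have hsec : ∀ e ∈ G.edgeSet, ∃ j, f j = e := fun e he => by rwa [← hf] at he
    choose σ hσ using hsec
    refine ⟨fun j => ∑ e, if h : e ∈ G.edgeSet then (if σ e h = j then a e else 0) else 0,
      fun j => ?_, ?_⟩
    · refine Finset.sum_nonneg fun e _ => ?_
      split_ifs
      exacts [ha e, le_rfl, le_rfl]
    · simp only [Finset.sum_smul]
      rw [Finset.sum_comm]
      refine Finset.sum_congr rfl fun e _ => ?_
      by_cases he : e ∈ G.edgeSet
      · simp [he, ite_smul, hσ e he]
      · simp [he, ha0 e he]
  · rintro ⟨b, hb, rfl⟩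
    refine ⟨fun e => ∑ j, if f j = e then b j else 0, fun e => ?_, fun e he => ?_, ?_⟩
    · refine Finset.sum_nonneg fun j _ => ?_
      split_ifs
      exacts [hb j, le_rfl]
    · refine Finset.sum_eq_zero fun j _ => ?_
      rw [if_neg]
      rintro rfl
      exact he (hf ▸ Set.mem_range_self j)
    · simp only [Finset.sum_smul]
      rw [Finset.sum_comm]
      refine Finset.sum_congr rfl fun j _ => ?_
      simp [ite_smul]

/-! ### Coordinates for the multi-path graph. -/

/-- The vertex at position `n` of the `i`-th path. -/
def pos {m : ℕ} (c : Fin m → ℕ) (i : Fin m) : ℕ → MPV c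
  | 0 => Sum.inl 0
  | n + 1 => if h : n < c i then Sum.inr ⟨i, ⟨n, h⟩⟩ else Sum.inl 1

/-- The vector with edge weights `b`. -/
def pv {m : ℕ} (c : Fin m → ℕ) (b : Fin m → ℕ → ℝ) : MPV c → ℝ
  | Sum.inl a => if a = 0 then ∑ i, b i 0 else ∑ i, b i (c i)
  | Sum.inr ⟨i, j⟩ => b i j + b i (j + 1)

/-- The edges of the multi-path graph. -/
def mpEdge {m : ℕ} (c : Fin m → ℕ) (J : Σ i : Fin m, Fin (c i + 1)) : Sym2 (MPV c) :=
  s(pos c J.1 J.2, pos c J.1 (J.2 + 1))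

theorem range_mpEdge {m : ℕ} (c : Fin m → ℕ) (hc : ∀ i, 1 ≤ c i) :
    Set.range (mpEdge c) = (multiPath c).edgeSet := by
  have key : ∀ u v : MPV c, mpRel c u v → s(u, v) ∈ Set.range (mpEdge c) := by
    rintro (a | ⟨i, j⟩) (a' | ⟨i', j'⟩) h
    · exact h.elim
    · rcases h with ⟨rfl, h⟩ | ⟨rfl, h⟩
      · refine ⟨⟨i', ⟨0, by omega⟩⟩, ?_⟩
        have : j' = ⟨0, hc i'⟩ := Fin.ext h
        subst this
        have := hc i'
        have h0 : 0 < c i' := this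
        simp only [mpEdge, pos, h0, dif_pos]
      · refine ⟨⟨i', ⟨c i', by omega⟩⟩, ?_⟩
        have h1 : pos c i' (c i') = Sum.inr ⟨i', j'⟩ := by
          rw [← h]
          simp [pos]
        have h2 : pos c i' (c i' + 1) = Sum.inl 1 := by simp [pos]
        simp only [mpEdge, h1, h2]
        exact Sym2.eq_swap
    · exact h.elim
    · obtain ⟨h1, h2⟩ := h
      have : i = i' := Fin.ext h1
      subst this
      refine ⟨⟨i, ⟨j + 1, by omega⟩⟩, ?_⟩
      have h1 : pos c i (j + 1) = Sum.inr ⟨i, j⟩ := by simp [pos]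
      have h3 : pos c i (j + 1 + 1) = Sum.inr ⟨i, j'⟩ := by
        rw [← h2]
        simp [pos]
      simp only [mpEdge, h1, h3]
  apply Set.Subset.antisymm
  · rintro _ ⟨⟨i, ⟨j, hj⟩⟩, rfl⟩
    simp only [mpEdge, SimpleGraph.mem_edgeSet, multiPath, SimpleGraph.fromRel_adj]
    have hci := hc i
    rcases j with _ | j
    · simp [pos, mpRel, hci]
      split_ifs
      · simp
      · omega
    · have hj' : j < c i := by omega
      by_cases h : j + 1 < c i
      · simp [pos, mpRel, hj', h]
      · simp [pos, mpRel, hj', h]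
        omega
  · intro e
    induction e using Sym2.ind with
    | _ u v =>
      intro h
      simp only [SimpleGraph.mem_edgeSet, multiPath, SimpleGraph.fromRel_adj] at h
      rcases h.2 with h | h
      · exact key _ _ h
      · rw [Sym2.eq_swap]
        exact key _ _ h

theorem edgeVec_mpEdge {m : ℕ} (c : Fin m → ℕ) (i : Fin m) (j : Fin (c i + 1)) (v : MPV c) :
    edgeVec (mpEdge c ⟨i, j⟩) v =
      (if v = pos c i j then 1 else 0) + (if v = pos c i (j + 1) then 1 else 0) := by
  have hne : pos c i j ≠ pos c i (j + 1) := by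
    obtain ⟨j, hj⟩ := j
    rcases j with _ | j
    · simp only [pos]
      split_ifs <;> simp
    · have hj' : j < c i := by omega
      simp only [pos, hj', dif_pos]
      split_ifs <;> simp
  simp only [edgeVec, mpEdge, Sym2.mem_iff]
  by_cases h1 : v = pos c i j
  · have h2 : v ≠ pos c i (j + 1) := fun h => hne (h1 ▸ h)
    simp [h1, hne]
  · simp [h1]

theorem sum_mpEdge {m : ℕ} (c : Fin m → ℕ) (b : Fin m → ℕ → ℝ) :
    ∑ J : (Σ i : Fin m, Fin (c i + 1)), b J.1 J.2 • edgeVec (mpEdge c J) = pv c b := by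
  funext v
  rw [Finset.sum_apply, Fintype.sum_sigma]
  simp only [Pi.smul_apply, smul_eq_mul, edgeVec_mpEdge]
  rcases v with a | ⟨i', j'⟩
  · by_cases ha : a = 0
    · subst ha
      simp only [pv, if_true]
      refine Finset.sum_congr rfl fun i _ => ?_
      rw [Finset.sum_eq_single (0 : Fin (c i + 1))]
      · simp only [pos, Fin.val_zero]
        split_ifs <;> simp_all
      · rintro ⟨j, hj⟩ - h0
        rcases j with _ | j
        · simp at h0
        · simp only [pos]
          split_ifs <;> simp_all
      · simp
    · have ha : a = 1 := by omega
      subst ha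
      simp only [pv, one_ne_zero, if_false]
      refine Finset.sum_congr rfl fun i _ => ?_
      rw [Finset.sum_eq_single (Fin.last (c i))]
      · have h1 : pos c i (c i) ≠ Sum.inl 1 := by
          rcases h : c i with _ | n
          · simp [pos]
          · simp [pos, h]
        have h2 : pos c i (c i + 1) = Sum.inl 1 := by simp [pos]
        simp [h1.symm, h2]
      · rintro ⟨j, hj⟩ - h0
        have hj' : j < c i := by
          have : j ≠ c i := fun h => h0 (Fin.ext h)
          omega
        have h2 : pos c i (j + 1) = Sum.inr ⟨i, ⟨j, hj'⟩⟩ := by simp [pos, hj']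
        have h1 : pos c i j ≠ Sum.inl 1 := by
          rcases j with _ | n
          · simp [pos]
          · have : n < c i := by omega
            simp [pos, this]
        simp [h1.symm, h2]
      · simp
  · simp only [pv]
    have hp : ∀ i n, (Sum.inr ⟨i', j'⟩ : MPV c) = pos c i n ↔ i = i' ∧ n = j' + 1 := by
      intro i n
      rcases n with _ | n
      · simp [pos]
      · simp only [pos]
        split_ifs with h
        · constructor
          · intro h
            simp only [Sum.inr.injEq, Sigma.mk.injEq] at h
            obtain ⟨rfl, h⟩ := h
            have := eq_of_heq h
            subst this
            simp
          · rintro ⟨rfl, h⟩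
            have : n = j' := by omega
            subst this
            rfl
        · simp only [reduceCtorEq, false_iff]
          rintro ⟨rfl, h'⟩
          have := j'.2
          omega
    simp only [hp]
    rw [Finset.sum_eq_single i']
    · have hj := j'.2
      simp only [true_and, mul_add, Finset.sum_add_distrib]
      rw [add_comm]
      congr 1
      · rw [Finset.sum_eq_single (⟨j', by omega⟩ : Fin (c i' + 1))]
        · simp
        · rintro ⟨j, hj⟩ - h0
          have : j ≠ j' := fun h => h0 (Fin.ext h)
          simp [this]
        · simp
      · rw [Finset.sum_eq_single (⟨j' + 1, by omega⟩ : Fin (c i' + 1))]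
        · simp
        · rintro ⟨j, hj⟩ - h0
          have : j ≠ j' + 1 := fun h => h0 (Fin.ext h)
          simp [this]
        · simp
    · intro i _ hi
      simp [hi]
    · simp

theorem extendB {m : ℕ} (c : Fin m → ℕ) (b : (Σ i : Fin m, Fin (c i + 1)) → ℝ) :
    ∃ b' : Fin m → ℕ → ℝ, ∀ J, b J = b' J.1 J.2 :=
  ⟨fun i n => if h : n < c i + 1 then b ⟨i, ⟨n, h⟩⟩ else 0, fun ⟨i, j⟩ => by
    simp only [j.2, dif_pos]⟩

theorem mem_cone_iff {m : ℕ} (c : Fin m → ℕ) (hc : ∀ i, 1 ≤ c i) (x : MPV c → ℝ) :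
    x ∈ edgeCone (multiPath c) ↔
      ∃ b : Fin m → ℕ → ℝ, (∀ i, ∀ j ≤ c i, 0 ≤ b i j) ∧ x = pv c b := by
  rw [edgeCone_eq_famCone _ _ (range_mpEdge c hc)]
  constructor
  · rintro ⟨b, hb, rfl⟩
    obtain ⟨b', h⟩ := extendB c b
    refine ⟨b', fun i j hj => ?_, ?_⟩
    · exact (hb ⟨i, ⟨j, by omega⟩⟩).trans_eq (h _)
    · simp only [h, sum_mpEdge]
  · rintro ⟨b, hb, rfl⟩
    exact ⟨fun J => b J.1 J.2, fun J => hb _ _ (by omega), (sum_mpEdge c b).symm⟩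

theorem mem_relint_cone_iff {m : ℕ} (c : Fin m → ℕ) (hc : ∀ i, 1 ≤ c i) (x : MPV c → ℝ) :
    x ∈ intrinsicInterior ℝ (edgeCone (multiPath c)) ↔
      ∃ b : Fin m → ℕ → ℝ, (∀ i, ∀ j ≤ c i, 0 < b i j) ∧ x = pv c b := by
  rw [edgeCone_eq_famCone _ _ (range_mpEdge c hc), mem_relint_famCone]
  constructor
  · rintro ⟨b, hb, rfl⟩
    obtain ⟨b', h⟩ := extendB c b
    refine ⟨b', fun i j hj => ?_, ?_⟩
    · exact (hb ⟨i, ⟨j, by omega⟩⟩).trans_eq (h _)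
    · simp only [h, sum_mpEdge]
  · rintro ⟨b, hb, rfl⟩
    exact ⟨fun J => b J.1 J.2, fun J => hb _ _ (by omega), (sum_mpEdge c b).symm⟩

/-! ### The vectors `α_k`. -/

/-- The vector `α_k`. -/
def alphaVec {m : ℕ} (c : Fin m → ℕ) (k : ℕ) : MPV c → ℝ :=
  Sum.elim (fun a : Fin 2 => if a = 0 then (k : ℝ) else ((m - k : ℕ) : ℝ)) (fun _ => 1)

/-- Alternating edge weights `d i, 1 - d i, d i, …` on the `i`-th path. -/
def altW {m : ℕ} (d : Fin m → ℝ) (i : Fin m) (j : ℕ) : ℝ := if Even j then d i else 1 - d i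

theorem pv_altW {m : ℕ} (c : Fin m → ℕ) (hc : ∀ i, Odd (c i)) (d : Fin m → ℝ) (k : ℕ)
    (hk : k ≤ m) (hd : ∑ i, d i = k) : pv c (altW d) = alphaVec c k := by
  funext v
  rcases v with a | ⟨i, j⟩
  · simp only [pv, alphaVec, Sum.elim_inl]
    split_ifs
    · simp [altW, hd]
    · have : ∀ i, altW d i (c i) = 1 - d i := fun i => by
        simp [altW, Nat.not_even_iff_odd.2 (hc i)]
      simp [this, hd, Nat.cast_sub hk]
  · simp only [pv, alphaVec, Sum.elim_inr, altW, Nat.even_add_one]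
    split_ifs <;> simp_all

theorem alphaVec_integral {m : ℕ} (c : Fin m → ℕ) (k : ℕ) : IsIntegralVec (alphaVec c k) := by
  rintro (a | v)
  · simp only [alphaVec, Sum.elim_inl]
    split_ifs
    · exact ⟨k, by simp⟩
    · exact ⟨(m - k : ℕ), by simp⟩
  · exact ⟨1, by simp [alphaVec]⟩

theorem alphaVec_relint {m : ℕ} (c : Fin m → ℕ) (hc : ∀ i, Odd (c i)) (k : ℕ) (h1 : 1 ≤ k)
    (h2 : k + 1 ≤ m) : alphaVec c k ∈ intrinsicInterior ℝ (edgeCone (multiPath c)) := by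
  rw [mem_relint_cone_iff c (fun i => (hc i).pos)]
  have hm : (0 : ℝ) < m := by exact_mod_cast (by omega : 0 < m)
  refine ⟨altW (fun _ => (k : ℝ) / m), fun i j _ => ?_, (pv_altW c hc _ k (by omega) ?_).symm⟩
  · have hk : (0 : ℝ) < k := by exact_mod_cast h1
    have hkm : (k : ℝ) < m := by exact_mod_cast h2
    simp only [altW]
    split_ifs
    · positivity
    · rw [sub_pos, div_lt_one hm]
      exact hkm
  · simp
    field_simp

theorem interp {m : ℕ} (lo hi : Fin m → ℝ) (h : ∀ i, lo i ≤ hi i) (k : ℝ)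
    (h1 : ∑ i, lo i ≤ k) (h2 : k ≤ ∑ i, hi i) :
    ∃ d : Fin m → ℝ, (∀ i, lo i ≤ d i ∧ d i ≤ hi i) ∧ ∑ i, d i = k := by
  rcases eq_or_lt_of_le h1 with h0 | h0
  · exact ⟨lo, fun i => ⟨le_rfl, h i⟩, h0⟩
  · have hpos : 0 < ∑ i, hi i - ∑ i, lo i := by linarith
    set θ := (k - ∑ i, lo i) / (∑ i, hi i - ∑ i, lo i) with hθ
    have t0 : 0 ≤ θ := div_nonneg (by linarith) hpos.le
    have t1 : θ ≤ 1 := by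
      rw [hθ, div_le_one hpos]
      linarith
    refine ⟨fun i => lo i + θ * (hi i - lo i), fun i => ?_, ?_⟩
    · have := h i
      constructor <;> nlinarith
    · rw [Finset.sum_add_distrib, ← Finset.mul_sum, Finset.sum_sub_distrib, hθ,
        div_mul_cancel₀ _ hpos.ne']
      ring

theorem exists_alpha {m : ℕ} (hm : 2 ≤ m) (c : Fin m → ℕ) (hc : ∀ i, Odd (c i))
    (b : Fin m → ℕ → ℝ) (hb : ∀ i, ∀ j ≤ c i, 0 < b i j) (hint : IsIntegralVec (pv c b)) :
    ∃ k : ℕ, 1 ≤ k ∧ k ≤ m - 1 ∧ ∃ b' : Fin m → ℕ → ℝ,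
      (∀ i, ∀ j ≤ c i, 0 ≤ b' i j) ∧ pv c b = alphaVec c k + pv c b' := by
  have hcong : ∀ i, ∀ j ≤ c i, ∃ n : ℤ, b i j = n + (-1) ^ j * b i 0 := by
    intro i j
    induction j with
    | zero => exact fun _ => ⟨0, by simp⟩
    | succ j ih =>
      intro hj
      obtain ⟨n, hn⟩ := ih (by omega)
      obtain ⟨p, hp⟩ := hint (Sum.inr ⟨i, ⟨j, by omega⟩⟩)
      simp only [pv] at hp
      refine ⟨p - n, ?_⟩
      push_cast
      rw [pow_succ]
      linarith
  have hE : ∀ i, ∃ je ≤ c i, Even je ∧ ∀ j ≤ c i, Even j → b i je ≤ b i j := by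
    intro i
    obtain ⟨j, hj, hmin⟩ := Finset.exists_min_image
      ((Finset.range (c i + 1)).filter Even) (b i) ⟨0, by simp⟩
    simp only [Finset.mem_filter, Finset.mem_range] at hj hmin
    exact ⟨j, by omega, hj.2, fun j' h h' => hmin j' ⟨by omega, h'⟩⟩
  have hO : ∀ i, ∃ jo ≤ c i, Odd jo ∧ ∀ j ≤ c i, Odd j → b i jo ≤ b i j := by
    intro i
    obtain ⟨j, hj, hmin⟩ := Finset.exists_min_image
      ((Finset.range (c i + 1)).filter Odd) (b i) ⟨c i, by simp [hc i]⟩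
    simp only [Finset.mem_filter, Finset.mem_range] at hj hmin
    exact ⟨j, by omega, hj.2, fun j' h h' => hmin j' ⟨by omega, h'⟩⟩
  choose je hje heE hemin using hE
  choose jo hjo hoO homin using hO
  choose N hN using fun i => hcong i (je i) (hje i)
  choose M hM using fun i => hcong i (jo i) (hjo i)
  simp only [(heE _).neg_one_pow, one_mul] at hN
  simp only [(hoO _).neg_one_pow, neg_one_mul] at hM
  have hle : ∀ i, 1 - b i (jo i) ≤ b i (je i) := by
    intro i
    have h1 := hb i _ (hje i)
    have h2 := hb i _ (hjo i)
    have h3 : (0 : ℝ) < (N i + M i : ℤ) := by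
      push_cast
      linarith [hN i, hM i]
    have h4 : (1 : ℝ) ≤ (N i + M i : ℤ) := by
      exact_mod_cast Int.cast_pos.1 h3
    push_cast at h4
    linarith [hN i, hM i]
  obtain ⟨X, hX⟩ := hint (Sum.inl 0)
  simp only [pv, if_true] at hX
  have hSe : ∑ i, b i (je i) = ((∑ i, N i + X : ℤ) : ℝ) := by
    push_cast
    rw [← hX, ← Finset.sum_add_distrib]
    exact Finset.sum_congr rfl fun i _ => hN i
  have hSo : ∑ i, b i (jo i) = ((∑ i, M i - X : ℤ) : ℝ) := by
    push_cast
    rw [← hX, ← Finset.sum_sub_distrib]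
    exact Finset.sum_congr rfl fun i _ => by rw [hM i]; ring
  set S := ∑ i, N i + X
  set T := ∑ i, M i - X
  have : Nonempty (Fin m) := ⟨⟨0, by omega⟩⟩
  have hS : 1 ≤ S := by
    have : (0 : ℝ) < (S : ℝ) := by
      rw [← hSe]
      exact Finset.sum_pos (fun i _ => hb i _ (hje i)) Finset.univ_nonempty
    exact Int.cast_pos.1 this
  have hT : 1 ≤ T := by
    have : (0 : ℝ) < (T : ℝ) := by
      rw [← hSo]
      exact Finset.sum_pos (fun i _ => hb i _ (hjo i)) Finset.univ_nonempty
    exact Int.cast_pos.1 this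
  have hlo : ∑ i, (1 - b i (jo i)) = ((m - T : ℤ) : ℝ) := by
    rw [Finset.sum_sub_distrib, hSo]
    simp
  have hST : (m : ℤ) - T ≤ S := by
    have : ((m - T : ℤ) : ℝ) ≤ (S : ℝ) := by
      rw [← hlo, ← hSe]
      exact Finset.sum_le_sum fun i _ => hle i
    exact_mod_cast this
  obtain ⟨k, hk1, hk2, hk3, hk4⟩ : ∃ k : ℕ, 1 ≤ k ∧ k ≤ m - 1 ∧ (m : ℤ) - T ≤ k ∧ (k : ℤ) ≤ S :=
    ⟨(max 1 ((m : ℤ) - T)).toNat, by omega, by omega, by omega, by omega⟩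
  obtain ⟨d, hd, hdk⟩ := interp _ _ hle (k : ℝ)
    (by rw [hlo]; exact_mod_cast hk3) (by rw [hSe]; exact_mod_cast hk4)
  refine ⟨k, hk1, hk2, fun i j => b i j - altW d i j, fun i j hj => ?_, ?_⟩
  · obtain ⟨h1, h2⟩ := hd i
    simp only [altW]
    split_ifs with h
    · linarith [hemin i j hj h]
    · linarith [homin i j hj (Nat.not_even_iff_odd.1 h)]
  · rw [← pv_altW c hc d k (by omega) hdk]
    funext v
    rcases v with a | ⟨i, j⟩
    · simp only [pv, Pi.add_apply]
      split_ifs <;> simp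
    · simp only [pv, Pi.add_apply]
      ring

theorem main_aux {m : ℕ} (hm : 2 ≤ m) (c : Fin m → ℕ) (hc : ∀ i, Odd (c i)) (x : MPV c → ℝ) :
    IsMinimalVec (multiPath c) x ↔ ∃ k : ℕ, 1 ≤ k ∧ k ≤ m - 1 ∧ x = alphaVec c k := by
  have hc1 : ∀ i, 1 ≤ c i := fun i => (hc i).pos
  constructor
  · rintro ⟨hx, hxi, hmin⟩
    obtain ⟨b, hb, rfl⟩ := (mem_relint_cone_iff c hc1 x).1 hx
    obtain ⟨k, hk1, hk2, b', hb', he⟩ := exists_alpha hm c hc b hb hxi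
    refine ⟨k, hk1, hk2, ?_⟩
    by_contra hne
    refine hmin ⟨alphaVec c k, pv c b', ⟨alphaVec_relint c hc k hk1 (by omega),
      alphaVec_integral c k⟩, ⟨(mem_cone_iff c hc1 _).2 ⟨b', hb', rfl⟩, ?_, ?_⟩, he⟩
    · intro v
      obtain ⟨p, hp⟩ := hxi v
      obtain ⟨q, hq⟩ := alphaVec_integral c k v
      refine ⟨p - q, ?_⟩
      have := congrFun he v
      simp only [Pi.add_apply] at this
      push_cast
      linarith
    · intro h0
      rw [h0, add_zero] at he
      exact hne he
  · rintro ⟨k, hk1, hk2, rfl⟩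
    refine ⟨alphaVec_relint c hc k hk1 (by omega), alphaVec_integral c k, ?_⟩
    rintro ⟨y, z, ⟨hy, hyi⟩, ⟨hz, hzi, hz0⟩, he⟩
    obtain ⟨b, hb, rfl⟩ := (mem_relint_cone_iff c hc1 y).1 hy
    obtain ⟨a, ha, rfl⟩ := (mem_cone_iff c hc1 z).1 hz
    have key : ∀ i, ∀ j < c i, a i j = 0 ∧ a i (j + 1) = 0 := by
      intro i j hj
      obtain ⟨p, hp⟩ := hyi (Sum.inr ⟨i, ⟨j, hj⟩⟩)
      have h := congrFun he (Sum.inr ⟨i, ⟨j, hj⟩⟩)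
      simp only [Pi.add_apply, alphaVec, Sum.elim_inr] at h
      rw [hp] at h
      simp only [pv] at h hp
      have h1 := hb i j (by omega)
      have h2 := hb i (j + 1) (by omega)
      have h3 := ha i j (by omega)
      have h4 := ha i (j + 1) (by omega)
      have hp0 : (0 : ℝ) < p := by linarith
      have hp1 : (1 : ℝ) ≤ p := by exact_mod_cast Int.cast_pos.1 hp0
      constructor <;> linarith
    apply hz0
    funext v
    rcases v with v | ⟨i, j⟩
    · simp only [pv, Pi.zero_apply]
      split_ifs
      · exact Finset.sum_eq_zero fun i _ => (key i 0 (hc1 i)).1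
      · refine Finset.sum_eq_zero fun i _ => ?_
        have h1 := hc1 i
        have := (key i (c i - 1) (by omega)).2
        rwa [Nat.sub_add_cancel h1] at this
    · simp only [pv, Pi.zero_apply]
      rw [(key i j j.2).1, (key i j j.2).2, add_zero]

/-- Minimal vectors of the relative interior of the edge cone of the even
multi-path graph `G_{2ℓ}`. -/
theorem statement6 (m : ℕ) (hm : 2 ≤ m) (ℓ : Fin m → ℕ) (hℓ : ∀ i, 1 ≤ ℓ i) :
    {x : MPV (fun i => 2 * ℓ i - 1) → ℝ |
        IsMinimalVec (multiPath (fun i => 2 * ℓ i - 1)) x} =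
      {x : MPV (fun i => 2 * ℓ i - 1) → ℝ | ∃ k : ℕ, 1 ≤ k ∧ k ≤ m - 1 ∧
        x = Sum.elim (fun a : Fin 2 => if a = 0 then (k : ℝ) else ((m - k : ℕ) : ℝ))
          (fun _ => 1)} := by
  ext x
  have hc : ∀ i, Odd (2 * ℓ i - 1) := fun i => ⟨ℓ i - 1, by have := hℓ i; omega⟩
  exact main_aux hm (fun i => 2 * ℓ i - 1) hc x

end Paper
end
end

section
/- Let m ≥ 2 and ℓ = (ℓ_1,…,ℓ_m) ∈ ℤ_{>0}^m, and let G = G_{2ℓ} be the even multi-path graph. A vector Σ_{i=1}^{m} Σ_{j=1}^{2ℓ_i−1} a_{i,j}·ε_{u_{i,j}} + b_1·ε_{v1} + b_2·ε_{v2} of ℝ^{V(G)} belongs to the edge cone ℝ₊(G) if and only if all of the following hold: (1) Σ_{j=1}^{m} Σ_{i=1}^{ℓ_j−1} a_{j,2i} + b_1 + b_2 = Σ_{j=1}^{m} Σ_{i=1}^{ℓ_j} a_{j,2i−1}; (2) a_{i,j} ≥ 0 for all 1 ≤ i ≤ m and 1 ≤ j ≤ 2ℓ_i−1; (3) b_1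 ≥ 0 and b_2 ≥ 0; (4) Σ_{j=1}^{s} Σ_{i=1}^{k_{p_j}} a_{p_j,2i} + b_1 ≥ Σ_{j=1}^{s} Σ_{i=1}^{k_{p_j}} a_{p_j,2i−1} for every subset {p_1,…,p_s} ⊆ {1,…,m} and all choices 1 ≤ k_{p_j} ≤ ℓ_{p_j}−1; (5) Σ_{j=1}^{s} Σ_{i=k_{p_j}−1}^{ℓ_{p_j}−1} a_{p_j,2i} + b_2 ≥ Σ_{j=1}^{s} Σ_{i=k_{p_j}}^{ℓ_{p_j}} a_{p_j,2i−1} for every subset {p_1,…,p_s} ⊆ {1,…,m} and all choices 2 ≤ k_{p_j} ≤ ℓ_{p_j}; (6) Σ_{j≠p} Σ_{i=1}^{ℓ_j−1} a_{j,2i} + b_1 + b_2 ≥ Σ_{j≠p} Σ_{i=1}^{ℓ_j} a_{j,2i−1} for every p ∈ {1,…,m}; (7) Σ_{j≠p} Σ_{i=1}^{ℓ_j−1} a_{j,2i} + Σ_{i=1}^{f_p} a_{p,2i} + b_1 + b_2 ≥ Σ_{j≠p} Σ_{i=1}^{ℓ_j} a_{j,2i−1} + Σ_{i=1}^{f_p}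 a_{p,2i−1} for every p ∈ {1,…,m} and 1 ≤ f_p ≤ ℓ_p−1; (8) Σ_{j≠p} Σ_{i=1}^{ℓ_j−1} a_{j,2i} + Σ_{i=k_p}^{ℓ_p} a_{p,2i−2} + b_1 + b_2 ≥ Σ_{j≠p} Σ_{i=1}^{ℓ_j} a_{j,2i−1} + Σ_{i=k_p}^{ℓ_p} a_{p,2i−1} for every p ∈ {1,…,m} and 2 ≤ k_p ≤ ℓ_p; (9) Σ_{j≠p} Σ_{i=1}^{ℓ_j−1} a_{j,2i} + Σ_{i=1}^{f_p} a_{p,2i} + Σ_{i=k_p}^{ℓ_p} a_{p,2i−2} + b_1 + b_2 ≥ Σ_{j≠p} Σ_{i=1}^{ℓ_j} a_{j,2i−1} + Σ_{i=1}^{f_p} a_{p,2i−1} + Σ_{i=k_p}^{ℓ_p} a_{p,2i−1} for every p ∈ {1,…,m} and 1 ≤ f_p < k_p−1 ≤ ℓ_p−1; (10) Σ_{i=f_j−1}^{k_j} a_{j,2i} ≥ Σ_{i=f_j}^{k_j} a_{j,2i−1} for every j ∈ {1,…,m} and 2 ≤ f_j ≤ k_j ≤ ℓ_j−1. -/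
open CategoryTheory MvPolynomial Finset
open scoped Classical

noncomputable section

namespace Paper

/-- the `j`-th vertex on path `i` -/
def vx {m : ℕ} (c : Fin m → ℕ) (i : Fin m) (j : ℕ) : MPV c :=
  if j = 0 then Sum.inl 0 else
    if h : j - 1 < c i then Sum.inr ⟨i, ⟨j - 1, h⟩⟩ else Sum.inl 1

lemma vx_inl0 {m : ℕ} (c : Fin m → ℕ) (i : Fin m) (j : ℕ) :
    (Sum.inl 0 = vx c i j) ↔ j = 0 := by
  unfold vx
  split_ifs <;> simp_all

lemma vx_inl1 {m : ℕ} (c : Fin m → ℕ) (i : Fin m) (j : ℕ) :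
    (Sum.inl 1 = vx c i j) ↔ c i < j := by
  unfold vx
  split_ifs <;> simp_all <;> omega

lemma vx_inr {m : ℕ} (c : Fin m → ℕ) (i i₀ : Fin m) (j : ℕ) (j₀ : Fin (c i₀)) :
    (Sum.inr ⟨i₀, j₀⟩ = vx c i j) ↔ i₀ = i ∧ j = (j₀ : ℕ) + 1 := by
  unfold vx
  constructor
  · intro h
    split_ifs at h with h1 h2
    · simp only [Sum.inr.injEq, Sigma.mk.injEq] at h
      obtain ⟨rfl, h⟩ := h
      have := eq_of_heq h
      subst this
      simp only [true_and]
      omega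
  · rintro ⟨rfl, rfl⟩
    simp

lemma vx_ne {m : ℕ} (c : Fin m → ℕ) (i : Fin m) (j : ℕ) (hj : j ≤ c i) :
    vx c i j ≠ vx c i (j + 1) := by
  intro h
  rcases hv : vx c i j with a | ⟨i₀, j₀⟩
  · fin_cases a
    · have h1 := (vx_inl0 c i j).1 hv.symm
      have h2 := (vx_inl0 c i (j+1)).1 (by rw [← h]; exact hv.symm)
      omega
    · have h1 := (vx_inl1 c i j).1 hv.symm
      omega
  · have h1 := (vx_inr c i i₀ j j₀).1 hv.symm
    have h2 := (vx_inr c i i₀ (j+1) j₀).1 (by rw [← h]; exact hv.symm)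
    omega

lemma edgeVec_vx {m : ℕ} (c : Fin m → ℕ) (i : Fin m) (j : ℕ) (hj : j ≤ c i) (v : MPV c) :
    edgeVec s(vx c i j, vx c i (j + 1)) v =
      (if v = vx c i j then 1 else 0) + (if v = vx c i (j + 1) then 1 else 0) := by
  unfold edgeVec
  have := vx_ne c i j hj
  by_cases h1 : v = vx c i j <;> by_cases h2 : v = vx c i (j + 1) <;> simp_all

lemma edge_mem {m : ℕ} (c : Fin m → ℕ) (hc : ∀ i, 1 ≤ c i) (i : Fin m) (j : ℕ) (hj : j ≤ c i) :
    s(vx c i j, vx c i (j + 1)) ∈ (multiPath c).edgeSet := by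
  rw [SimpleGraph.mem_edgeSet, multiPath, SimpleGraph.fromRel_adj]
  refine ⟨vx_ne c i j hj, ?_⟩
  have := hc i
  rcases Nat.eq_zero_or_pos j with rfl | hj0
  · left
    have h1 : vx c i 0 = Sum.inl 0 := ((vx_inl0 c i 0).2 rfl).symm
    have h2 : vx c i (0+1) = Sum.inr ⟨i, ⟨0, by omega⟩⟩ := ((vx_inr c i i _ ⟨0, by omega⟩).2 ⟨rfl, by simp⟩).symm
    rw [h1, h2]
    simp [mpRel]
  · have h1 : vx c i j = Sum.inr ⟨i, ⟨j-1, by omega⟩⟩ :=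
      ((vx_inr c i i _ ⟨j-1, by omega⟩).2 ⟨rfl, by simp; omega⟩).symm
    rcases Nat.lt_or_ge j (c i) with h | h
    · left
      have h2 : vx c i (j+1) = Sum.inr ⟨i, ⟨j, by omega⟩⟩ :=
        ((vx_inr c i i _ ⟨j, by omega⟩).2 ⟨rfl, by simp⟩).symm
      rw [h1, h2]
      simp [mpRel]
      omega
    · right
      have h2 : vx c i (j+1) = Sum.inl 1 := ((vx_inl1 c i (j+1)).2 (by omega)).symm
      rw [h1, h2]
      simp [mpRel]
      omega

lemma rel_edge {m : ℕ} (c : Fin m → ℕ) (u v : MPV c) (h : mpRel c u v) :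
    ∃ i : Fin m, ∃ j ≤ c i, s(u, v) = s(vx c i j, vx c i (j + 1)) := by
  rcases u with a | ⟨i, j⟩ <;> rcases v with b | ⟨i', j'⟩
  · simp [mpRel] at h
  · simp only [mpRel] at h
    rcases h with ⟨rfl, h⟩ | ⟨rfl, h⟩
    · refine ⟨i', 0, by omega, ?_⟩
      rw [← (vx_inl0 c i' 0).2 rfl, ← (vx_inr c i' i' (0+1) j').2 ⟨rfl, by omega⟩]
    · refine ⟨i', c i', le_rfl, ?_⟩
      rw [← (vx_inl1 c i' (c i' + 1)).2 (by omega), ← (vx_inr c i' i' (c i') j').2 ⟨rfl, by omega⟩,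
        Sym2.eq_swap]
  · simp [mpRel] at h
  · simp only [mpRel] at h
    obtain ⟨h1, h2⟩ := h
    have h1 := Fin.ext h1
    subst h1
    refine ⟨i, j + 1, by omega, ?_⟩
    rw [← (vx_inr c i i (j+1) j).2 ⟨rfl, by omega⟩, ← (vx_inr c i i (j+1+1) j').2 ⟨rfl, by omega⟩]

lemma edge_exists {m : ℕ} (c : Fin m → ℕ) (e : Sym2 (MPV c)) (he : e ∈ (multiPath c).edgeSet) :
    ∃ i : Fin m, ∃ j ≤ c i, e = s(vx c i j, vx c i (j + 1)) := by
  induction e using Sym2.ind with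
  | _ u v =>
    rw [SimpleGraph.mem_edgeSet, multiPath, SimpleGraph.fromRel_adj] at he
    rcases he.2 with h | h
    · exact rel_edge c u v h
    · rw [Sym2.eq_swap]; exact rel_edge c v u h

lemma cone_iff {m : ℕ} (c : Fin m → ℕ) (hc : ∀ i, 1 ≤ c i) (x : MPV c → ℝ) :
    x ∈ edgeCone (multiPath c) ↔ ∃ w : Fin m → ℕ → ℝ, (∀ i, ∀ j ≤ c i, 0 ≤ w i j) ∧
      x = ∑ i, ∑ j ∈ Finset.range (c i + 1), w i j • edgeVec s(vx c i j, vx c i (j + 1)) := by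
  constructor
  · rintro ⟨α, h0, hE, rfl⟩
    have key : ∀ e : Sym2 (MPV c), ∃ w : Fin m → ℕ → ℝ, (∀ i, ∀ j ≤ c i, 0 ≤ w i j) ∧
      α e • edgeVec e =
        ∑ i, ∑ j ∈ Finset.range (c i + 1), w i j • edgeVec s(vx c i j, vx c i (j + 1)) := by
      intro e
      by_cases he : e ∈ (multiPath c).edgeSet
      · obtain ⟨i₀, j₀, hj, rfl⟩ := edge_exists c e he
        refine ⟨fun i j => if i = i₀ ∧ j = j₀ then α s(vx c i₀ j₀, vx c i₀ (j₀ + 1)) else 0, ?_, ?_⟩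
        · intro i j _
          dsimp only
          split_ifs
          · exact h0 _
          · exact le_rfl
        · rw [Finset.sum_eq_single i₀]
          · rw [Finset.sum_eq_single j₀]
            · simp
            · intro j _ hne; simp [hne]
            · intro h; simp at h; omega
          · intro i _ hne
            simp [hne]
          · simp
      · exact ⟨fun _ _ => 0, fun _ _ _ => le_rfl, by simp [hE e he]⟩
    choose W hW0 hW using key
    refine ⟨fun i j => ∑ e, W e i j, fun i j hj => Finset.sum_nonneg fun e _ => hW0 e i j hj, ?_⟩
    simp_rw [hW, Finset.sum_smul]
    rw [Finset.sum_comm]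
    refine Finset.sum_congr rfl fun i _ => ?_
    rw [Finset.sum_comm]
  · rintro ⟨w, hw, rfl⟩
    refine ⟨fun e => ∑ i, ∑ j ∈ Finset.range (c i + 1),
      if e = s(vx c i j, vx c i (j + 1)) then w i j else 0, ?_, ?_, ?_⟩
    · intro e
      refine Finset.sum_nonneg fun i _ => Finset.sum_nonneg fun j hj => ?_
      rw [Finset.mem_range] at hj
      split_ifs
      · exact hw i j (by omega)
      · exact le_rfl
    · intro e he
      refine Finset.sum_eq_zero fun i _ => Finset.sum_eq_zero fun j hj => ?_
      rw [Finset.mem_range] at hj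
      rw [if_neg]
      rintro rfl
      exact he (edge_mem c hc i j (by omega))
    · simp_rw [Finset.sum_smul]
      rw [Finset.sum_comm]
      refine Finset.sum_congr rfl fun i _ => ?_
      rw [Finset.sum_comm]
      refine Finset.sum_congr rfl fun j _ => ?_
      simp [ite_smul]

lemma eval_sum {m : ℕ} (c : Fin m → ℕ) (w : Fin m → ℕ → ℝ) (v : MPV c) :
    (∑ i, ∑ j ∈ Finset.range (c i + 1), w i j • edgeVec s(vx c i j, vx c i (j + 1))) v =
    ∑ i, ((∑ j ∈ Finset.range (c i + 1), if v = vx c i j then w i j else 0) +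
      ∑ j ∈ Finset.range (c i + 1), if v = vx c i (j+1) then w i j else 0) := by
  rw [Finset.sum_apply]
  refine Finset.sum_congr rfl fun i _ => ?_
  rw [Finset.sum_apply, ← Finset.sum_add_distrib]
  refine Finset.sum_congr rfl fun j hj => ?_
  rw [Finset.mem_range] at hj
  rw [Pi.smul_apply, edgeVec_vx c i j (by omega)]
  simp [mul_add]

lemma cone_iff' {m : ℕ} (c : Fin m → ℕ) (hc : ∀ i, 1 ≤ c i) (x : MPV c → ℝ) :
    x ∈ edgeCone (multiPath c) ↔ ∃ w : Fin m → ℕ → ℝ, (∀ i, ∀ j ≤ c i, 0 ≤ w i j) ∧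
      x (Sum.inl 0) = ∑ i, w i 0 ∧ x (Sum.inl 1) = ∑ i, w i (c i) ∧
      ∀ i, ∀ j : Fin (c i), x (Sum.inr ⟨i, j⟩) = w i j + w i (j + 1) := by
  rw [cone_iff c hc]
  refine exists_congr fun w => and_congr_right fun _ => ?_
  have e0 : (∑ i, ∑ j ∈ Finset.range (c i + 1),
      w i j • edgeVec s(vx c i j, vx c i (j + 1))) (Sum.inl 0) = ∑ i, w i 0 := by
    rw [eval_sum]
    refine Finset.sum_congr rfl fun i _ => ?_
    simp [vx_inl0]
  have e1 : (∑ i, ∑ j ∈ Finset.range (c i + 1),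
      w i j • edgeVec s(vx c i j, vx c i (j + 1))) (Sum.inl 1) = ∑ i, w i (c i) := by
    rw [eval_sum]
    refine Finset.sum_congr rfl fun i _ => ?_
    simp only [vx_inl1]
    rw [Finset.sum_eq_zero, Finset.sum_eq_single (c i)]
    · simp
    · intro j hj hne
      rw [Finset.mem_range] at hj
      rw [if_neg (by omega)]
    · simp
    · intro j hj
      rw [Finset.mem_range] at hj
      rw [if_neg (by omega)]
  have e2 : ∀ i₀, ∀ j₀ : Fin (c i₀), (∑ i, ∑ j ∈ Finset.range (c i + 1),
      w i j • edgeVec s(vx c i j, vx c i (j + 1))) (Sum.inr ⟨i₀, j₀⟩)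
        = w i₀ j₀ + w i₀ (j₀ + 1) := by
    intro i₀ j₀
    rw [eval_sum, Finset.sum_eq_single i₀]
    · simp only [vx_inr, true_and, add_left_inj]
      have := j₀.2
      rw [Finset.sum_ite_eq', Finset.sum_ite_eq', if_pos (by simp), if_pos (by simp),
        add_comm]
    · intro i _ hne
      simp [vx_inr, hne.symm]
    · simp
  constructor
  · rintro rfl
    exact ⟨e0, e1, e2⟩
  · rintro ⟨h0, h1, h2⟩
    funext v
    rcases v with a | ⟨i, j⟩
    · fin_cases a
      · exact h0.trans e0.symm
      · exact h1.trans e1.symm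
    · exact (h2 i j).trans (e2 i j).symm

lemma exists_between_sum {m : ℕ} (L U : Fin m → ℝ) (b : ℝ) (h : ∀ i, L i ≤ U i)
    (h1 : ∑ i, L i ≤ b) (h2 : b ≤ ∑ i, U i) :
    ∃ t : Fin m → ℝ, (∀ i, L i ≤ t i ∧ t i ≤ U i) ∧ ∑ i, t i = b := by
  rcases eq_or_lt_of_le (h1.trans h2) with he | hlt
  · exact ⟨L, fun i => ⟨le_rfl, h i⟩, by linarith⟩
  · have hd : 0 < ∑ i, U i - ∑ i, L i := by linarith
    set θ := (b - ∑ i, L i) / (∑ i, U i - ∑ i, L i) with hθ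
    have h0 : 0 ≤ θ := div_nonneg (by linarith) hd.le
    have h1' : θ ≤ 1 := (div_le_one hd).2 (by linarith)
    refine ⟨fun i => L i + θ * (U i - L i), fun i => ⟨?_, ?_⟩, ?_⟩
    · nlinarith [h i]
    · nlinarith [h i]
    · rw [Finset.sum_add_distrib, ← Finset.mul_sum, Finset.sum_sub_distrib, hθ,
        div_mul_cancel₀ _ hd.ne']
      ring

/-- even partial sums -/
def evS {m : ℕ} (a : Fin m → ℕ → ℝ) (p : Fin m) (k : ℕ) : ℝ := ∑ i ∈ Finset.Icc 1 k, a p (2 * i)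
/-- odd partial sums -/
def odS {m : ℕ} (a : Fin m → ℕ → ℝ) (p : Fin m) (k : ℕ) : ℝ :=
  ∑ i ∈ Finset.Icc 1 k, a p (2 * i - 1)

lemma evS_zero {m : ℕ} (a : Fin m → ℕ → ℝ) (p : Fin m) : evS a p 0 = 0 := by simp [evS]
lemma odS_zero {m : ℕ} (a : Fin m → ℕ → ℝ) (p : Fin m) : odS a p 0 = 0 := by simp [odS]
lemma evS_succ {m : ℕ} (a : Fin m → ℕ → ℝ) (p : Fin m) (k : ℕ) :
    evS a p (k + 1) = evS a p k + a p (2 * k + 2) := by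
  unfold evS
  rw [Finset.sum_Icc_succ_top (by omega)]
  rfl
lemma odS_succ {m : ℕ} (a : Fin m → ℕ → ℝ) (p : Fin m) (k : ℕ) :
    odS a p (k + 1) = odS a p k + a p (2 * k + 1) := by
  unfold odS
  rw [Finset.sum_Icc_succ_top (by omega)]
  rfl

lemma sum_Icc_diff (g : ℕ → ℝ) (s k : ℕ) (h : s ≤ k) :
    ∑ i ∈ Finset.Icc (s + 1) k, g i = ∑ i ∈ Finset.Icc 1 k, g i - ∑ i ∈ Finset.Icc 1 s, g i := by
  induction k, h using Nat.le_induction with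
  | base => simp
  | succ k hk ih =>
    rw [Finset.sum_Icc_succ_top (by omega), ih, Finset.sum_Icc_succ_top (by omega)]
    ring

lemma evS_diff {m : ℕ} (a : Fin m → ℕ → ℝ) (p : Fin m) (s k : ℕ) (h : s ≤ k) :
    ∑ i ∈ Finset.Icc (s + 1) k, a p (2 * i) = evS a p k - evS a p s :=
  sum_Icc_diff _ s k h
lemma odS_diff {m : ℕ} (a : Fin m → ℕ → ℝ) (p : Fin m) (s k : ℕ) (h : s ≤ k) :
    ∑ i ∈ Finset.Icc (s + 1) k, a p (2 * i - 1) = odS a p k - odS a p s :=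
  sum_Icc_diff _ s k h
lemma evS_diff' {m : ℕ} (a : Fin m → ℕ → ℝ) (p : Fin m) (s k : ℕ) (h : s ≤ k) :
    ∑ i ∈ Finset.Icc (s + 2) (k + 1), a p (2 * i - 2) = evS a p k - evS a p s := by
  rw [← evS_diff a p s k h]
  induction k, h using Nat.le_induction with
  | base => simp
  | succ k hk ih =>
    rw [Finset.sum_Icc_succ_top (by omega), ih, Finset.sum_Icc_succ_top (by omega)]
    rfl

/-- Existence of edge weights in terms of the weights of the first edges. -/
lemma w_iff (m : ℕ) (ℓ : Fin m → ℕ) (hℓ : ∀ i, 1 ≤ ℓ i)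
    (a : Fin m → ℕ → ℝ) (b₁ b₂ : ℝ) :
    (∃ w : Fin m → ℕ → ℝ, (∀ i, ∀ j ≤ 2 * ℓ i - 1, 0 ≤ w i j) ∧
      b₁ = ∑ i, w i 0 ∧ b₂ = ∑ i, w i (2 * ℓ i - 1) ∧
      ∀ i, ∀ j : Fin (2 * ℓ i - 1), a i (j + 1) = w i j + w i (j + 1)) ↔
    ∃ t : Fin m → ℝ, b₁ = ∑ i, t i ∧
      b₂ = ∑ i, (odS a i (ℓ i) - evS a i (ℓ i - 1) - t i) ∧
      ∀ i, ∀ k < ℓ i, 0 ≤ t i + evS a i k - odS a i k ∧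
        0 ≤ odS a i (k + 1) - evS a i k - t i := by
  constructor
  · rintro ⟨w, h0, h1, h2, h3⟩
    have key : ∀ i, ∀ k < ℓ i, w i (2 * k) = w i 0 + evS a i k - odS a i k ∧
        w i (2 * k + 1) = odS a i (k + 1) - evS a i k - w i 0 := by
      intro i k
      induction k with
      | zero =>
        intro hk
        have := h3 i ⟨0, by omega⟩
        simp only [evS_zero, odS_zero, odS_succ, mul_zero, zero_add] at *
        constructor <;> linarith
      | succ k ih =>
        intro hk
        obtain ⟨i1, i2⟩ := ih (by omega)
        have e1 := h3 i ⟨2 * k + 1, by omega⟩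
        have e2 := h3 i ⟨2 * k + 2, by omega⟩
        simp only [odS_succ, evS_succ, show 2 * (k + 1) = 2 * k + 2 by ring] at *
        constructor <;> linarith
    refine ⟨fun i => w i 0, h1, ?_, ?_⟩
    · rw [h2]
      refine Finset.sum_congr rfl fun i _ => ?_
      have := hℓ i
      have := (key i (ℓ i - 1) (by omega)).2
      rw [show ℓ i - 1 + 1 = ℓ i by omega, show 2 * (ℓ i - 1) + 1 = 2 * ℓ i - 1 by omega] at this
      exact this
    · intro i k hk
      obtain ⟨k1, k2⟩ := key i k hk
      rw [← k1, ← k2]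
      exact ⟨h0 _ _ (by omega), h0 _ _ (by omega)⟩
  · rintro ⟨t, h1, h2, h3⟩
    have ev : ∀ k, (2 * k) % 2 = 0 ∧ (2 * k) / 2 = k := by intro k; omega
    have od : ∀ k, (2 * k + 1) % 2 ≠ 0 ∧ (2 * k + 1) / 2 = k := by intro k; omega
    let w : Fin m → ℕ → ℝ := fun i j => if j % 2 = 0 then t i + evS a i (j / 2) - odS a i (j / 2)
      else odS a i (j / 2 + 1) - evS a i (j / 2) - t i
    have we : ∀ i k, w i (2 * k) = t i + evS a i k - odS a i k := by
      intro i k; simp only [w, ev, if_true]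
    have wo : ∀ i k, w i (2 * k + 1) = odS a i (k + 1) - evS a i k - t i := by
      intro i k; simp only [w, od, if_false]
    refine ⟨w, ?_, ?_, ?_, ?_⟩
    · intro i j hj
      have := hℓ i
      rcases Nat.even_or_odd' j with ⟨k, rfl | rfl⟩
      · rw [we]; exact (h3 i k (by omega)).1
      · rw [wo]; exact (h3 i k (by omega)).2
    · rw [h1]
      refine Finset.sum_congr rfl fun i _ => ?_
      have := we i 0
      simp only [evS_zero, odS_zero, mul_zero] at this
      linarith
    · rw [h2]
      refine Finset.sum_congr rfl fun i _ => ?_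
      have := hℓ i
      have := wo i (ℓ i - 1)
      rw [show ℓ i - 1 + 1 = ℓ i by omega, show 2 * (ℓ i - 1) + 1 = 2 * ℓ i - 1 by omega] at this
      rw [this]
    · rintro i ⟨j, hj⟩
      dsimp only
      rcases Nat.even_or_odd' j with ⟨k, rfl | rfl⟩
      · rw [we, wo, odS_succ]; ring
      · rw [show 2 * k + 1 + 1 = 2 * (k + 1) by ring, wo, we, evS_succ]; ring_nf

lemma t_iff (m : ℕ) (ℓ : Fin m → ℕ) (hℓ : ∀ i, 1 ≤ ℓ i)
    (A O : Fin m → ℕ → ℝ) (b₁ b₂ : ℝ) :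
    (∃ t : Fin m → ℝ, b₁ = ∑ i, t i ∧
      b₂ = ∑ i, (O i (ℓ i) - A i (ℓ i - 1) - t i) ∧
      ∀ i, ∀ k < ℓ i, 0 ≤ t i + A i k - O i k ∧
        0 ≤ O i (k + 1) - A i k - t i) ↔
    b₁ + b₂ = ∑ i, (O i (ℓ i) - A i (ℓ i - 1)) ∧ 
    (∀ i, ∀ k < ℓ i, ∀ k' < ℓ i, O i k - A i k ≤ O i (k' + 1) - A i k') ∧
    (∀ κ : Fin m → ℕ, (∀ i, κ i < ℓ i) → ∑ i, (O i (κ i) - A i (κ i)) ≤ b₁) ∧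
    (∀ κ : Fin m → ℕ, (∀ i, κ i < ℓ i) → b₁ ≤ ∑ i, (O i (κ i + 1) - A i (κ i))) := by
  constructor
  · rintro ⟨t, h1, h2, h3⟩
    refine ⟨?_, ?_, ?_, ?_⟩
    · rw [h1, h2, ← Finset.sum_add_distrib]
      exact Finset.sum_congr rfl fun i _ => by ring
    · intro i k hk k' hk'
      linarith [(h3 i k hk).1, (h3 i k' hk').2]
    · intro κ hκ
      rw [h1]
      exact Finset.sum_le_sum fun i _ => by linarith [(h3 i _ (hκ i)).1]
    · intro κ hκ
      rw [h1]
      exact Finset.sum_le_sum fun i _ => by linarith [(h3 i _ (hκ i)).2]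
  · rintro ⟨h1, h2, h3, h4⟩
    have hne : ∀ i, (Finset.range (ℓ i)).Nonempty := fun i => ⟨0, Finset.mem_range.2 (hℓ i)⟩
    choose K hK hK' using fun i =>
      Finset.exists_max_image (Finset.range (ℓ i)) (fun k => O i k - A i k) (hne i)
    choose J hJ hJ' using fun i =>
      Finset.exists_min_image (Finset.range (ℓ i)) (fun k => O i (k + 1) - A i k) (hne i)
    simp only [Finset.mem_range] at hK hK' hJ hJ'
    obtain ⟨t, ht, hs⟩ := exists_between_sum (fun i => O i (K i) - A i (K i))
      (fun i => O i (J i + 1) - A i (J i)) b₁ (fun i => h2 i _ (hK i) _ (hJ i)) (h3 K hK) (h4 J hJ)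
    refine ⟨t, hs.symm, ?_, ?_⟩
    · rw [Finset.sum_sub_distrib, hs, ← h1]; ring
    · intro i k hk
      have := ht i
      constructor
      · linarith [hK' i k hk]
      · linarith [hJ' i k hk]

lemma subset_iff {m : ℕ} (ℓ d : Fin m → ℕ) (hd : ∀ i, d i < ℓ i) (f : Fin m → ℕ → ℝ)
    (hf : ∀ i, f i (d i) = 0) (b : ℝ) :
    (∀ κ : Fin m → ℕ, (∀ i, κ i < ℓ i) → ∑ i, f i (κ i) ≤ b) ↔
    (∀ P : Finset (Fin m), ∀ κ : Fin m → ℕ, (∀ p ∈ P, κ p < ℓ p ∧ κ p ≠ d p) →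
      ∑ p ∈ P, f p (κ p) ≤ b) := by
  constructor
  · intro h P κ hκ
    refine le_trans (le_of_eq ?_) (h (fun i => if i ∈ P then κ i else d i) ?_)
    · rw [← Finset.sum_subset (Finset.subset_univ P)]
      · refine Finset.sum_congr rfl fun i hi => ?_
        rw [if_pos hi]
      · intro i _ hi
        rw [if_neg hi, hf]
    · intro i
      try dsimp only
      split_ifs with hi
      · exact (hκ i hi).1
      · exact hd i
  · intro h κ hκ
    refine le_trans (le_of_eq ?_) (h (Finset.univ.filter fun i => κ i ≠ d i) κ ?_)
    · symm
      apply Finset.sum_subset (Finset.subset_univ _)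
      intro i _ hi
      simp only [Finset.mem_filter, Finset.mem_univ, true_and, not_not] at hi
      rw [hi, hf]
    · intro p hp
      exact ⟨hκ p, (Finset.mem_filter.1 hp).2⟩

/-- The inequality description of the edge cone of the even multi-path
graph `G_{2ℓ}`.  The vector has coordinate `a i j` at the interior vertex `u_{i,j}`
(`1 ≤ j ≤ 2ℓ_i - 1`), coordinate `b₁` at `v1` and `b₂` at `v2`. -/
theorem statement7 (m : ℕ) (hm : 2 ≤ m) (ℓ : Fin m → ℕ) (hℓ : ∀ i, 1 ≤ ℓ i)
    (a : Fin m → ℕ → ℝ) (b₁ b₂ : ℝ) :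
    (Sum.elim (![b₁, b₂])
        (fun p : Σ i : Fin m, Fin (2 * ℓ i - 1) => a p.1 ((p.2 : ℕ) + 1)) :
          MPV (fun i => 2 * ℓ i - 1) → ℝ) ∈ edgeCone (multiPath (fun i => 2 * ℓ i - 1)) ↔
      ((∑ j : Fin m, ∑ i ∈ Finset.Icc 1 (ℓ j - 1), a j (2 * i)) + b₁ + b₂ =
          ∑ j : Fin m, ∑ i ∈ Finset.Icc 1 (ℓ j), a j (2 * i - 1)) ∧
      (∀ i : Fin m, ∀ j : ℕ, 1 ≤ j → j ≤ 2 * ℓ i - 1 → 0 ≤ a i j) ∧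
      (0 ≤ b₁ ∧ 0 ≤ b₂) ∧
      (∀ P : Finset (Fin m), ∀ κ : Fin m → ℕ, (∀ p ∈ P, 1 ≤ κ p ∧ κ p ≤ ℓ p - 1) →
        (∑ p ∈ P, ∑ i ∈ Finset.Icc 1 (κ p), a p (2 * i)) + b₁ ≥
          ∑ p ∈ P, ∑ i ∈ Finset.Icc 1 (κ p), a p (2 * i - 1)) ∧
      (∀ P : Finset (Fin m), ∀ κ : Fin m → ℕ, (∀ p ∈ P, 2 ≤ κ p ∧ κ p ≤ ℓ p) →
        (∑ p ∈ P, ∑ i ∈ Finset.Icc (κ p - 1) (ℓ p - 1), a p (2 * i)) + b₂ ≥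
          ∑ p ∈ P, ∑ i ∈ Finset.Icc (κ p) (ℓ p), a p (2 * i - 1)) ∧
      (∀ p : Fin m,
        (∑ j ∈ Finset.univ.erase p, ∑ i ∈ Finset.Icc 1 (ℓ j - 1), a j (2 * i)) + b₁ + b₂ ≥
          ∑ j ∈ Finset.univ.erase p, ∑ i ∈ Finset.Icc 1 (ℓ j), a j (2 * i - 1)) ∧
      (∀ p : Fin m, ∀ f : ℕ, 1 ≤ f → f ≤ ℓ p - 1 →
        (∑ j ∈ Finset.univ.erase p, ∑ i ∈ Finset.Icc 1 (ℓ j - 1), a j (2 * i)) +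
            (∑ i ∈ Finset.Icc 1 f, a p (2 * i)) + b₁ + b₂ ≥
          (∑ j ∈ Finset.univ.erase p, ∑ i ∈ Finset.Icc 1 (ℓ j), a j (2 * i - 1)) +
            ∑ i ∈ Finset.Icc 1 f, a p (2 * i - 1)) ∧
      (∀ p : Fin m, ∀ k : ℕ, 2 ≤ k → k ≤ ℓ p →
        (∑ j ∈ Finset.univ.erase p, ∑ i ∈ Finset.Icc 1 (ℓ j - 1), a j (2 * i)) +
            (∑ i ∈ Finset.Icc k (ℓ p), a p (2 * i - 2)) + b₁ + b₂ ≥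
          (∑ j ∈ Finset.univ.erase p, ∑ i ∈ Finset.Icc 1 (ℓ j), a j (2 * i - 1)) +
            ∑ i ∈ Finset.Icc k (ℓ p), a p (2 * i - 1)) ∧
      (∀ p : Fin m, ∀ f k : ℕ, 1 ≤ f → f < k - 1 → k - 1 ≤ ℓ p - 1 →
        (∑ j ∈ Finset.univ.erase p, ∑ i ∈ Finset.Icc 1 (ℓ j - 1), a j (2 * i)) +
            (∑ i ∈ Finset.Icc 1 f, a p (2 * i)) +
            (∑ i ∈ Finset.Icc k (ℓ p), a p (2 * i - 2)) + b₁ + b₂ ≥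
          (∑ j ∈ Finset.univ.erase p, ∑ i ∈ Finset.Icc 1 (ℓ j), a j (2 * i - 1)) +
            (∑ i ∈ Finset.Icc 1 f, a p (2 * i - 1)) +
            ∑ i ∈ Finset.Icc k (ℓ p), a p (2 * i - 1)) ∧
      (∀ j : Fin m, ∀ f k : ℕ, 2 ≤ f → f ≤ k → k ≤ ℓ j - 1 →
        (∑ i ∈ Finset.Icc (f - 1) k, a j (2 * i)) ≥ ∑ i ∈ Finset.Icc f k, a j (2 * i - 1)) := by
  have hc : ∀ i, 1 ≤ (fun i => 2 * ℓ i - 1) i := by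
    intro i
    have := hℓ i
    try dsimp only
    omega
  rw [cone_iff' _ hc]
  refine Iff.trans (w_iff m ℓ hℓ a b₁ b₂) ?_
  rw [t_iff m ℓ hℓ (evS a) (odS a)]
  rw [subset_iff ℓ (fun _ => 0) (fun i => hℓ i) (fun i k => odS a i k - evS a i k)
    (fun i => by simp [evS_zero, odS_zero])]
  have fe : ∀ p k, ∑ i ∈ Finset.Icc 1 k, a p (2 * i) = evS a p k := fun _ _ => rfl
  have fo : ∀ p k, ∑ i ∈ Finset.Icc 1 k, a p (2 * i - 1) = odS a p k := fun _ _ => rfl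
  have er : ∀ (p : Fin m) (f : Fin m → ℝ),
      ∑ j ∈ Finset.univ.erase p, f j = ∑ j, f j - f p := fun p f =>
    Finset.sum_erase_eq_sub (Finset.mem_univ p)
  simp only [fe, fo, er]
  have hs4 := subset_iff ℓ (fun i => ℓ i - 1) (fun i => Nat.sub_lt (hℓ i) one_pos)
    (fun i k => (odS a i (ℓ i) - evS a i (ℓ i - 1)) - (odS a i (k + 1) - evS a i k))
    (fun i => by simp [Nat.sub_add_cancel (hℓ i)]) b₂
  have h4iff : b₁ + b₂ = ∑ i, (odS a i (ℓ i) - evS a i (ℓ i - 1)) →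
      ((∀ κ : Fin m → ℕ, (∀ i, κ i < ℓ i) → b₁ ≤ ∑ i, (odS a i (κ i + 1) - evS a i (κ i))) ↔
      (∀ κ : Fin m → ℕ, (∀ i, κ i < ℓ i) → ∑ i, ((odS a i (ℓ i) - evS a i (ℓ i - 1)) -
        (odS a i (κ i + 1) - evS a i (κ i))) ≤ b₂)) := by
    intro h1
    refine forall_congr' fun κ => imp_congr_right fun _ => ?_
    rw [Finset.sum_sub_distrib (fun i => odS a i (ℓ i) - evS a i (ℓ i - 1)), ← h1]
    constructor <;> intro <;> linarith
  constructor
  · rintro ⟨h1, h2, h3, h4⟩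
    replace h4 := hs4.1 ((h4iff h1).1 h4)
    have h1' := h1
    rw [Finset.sum_sub_distrib] at h1'
    refine ⟨by linarith, ?_, ⟨?_, ?_⟩, ?_, ?_, ?_, ?_, ?_, ?_, ?_⟩
    · intro i j hj1 hj2
      rcases Nat.even_or_odd' j with ⟨k, rfl | rfl⟩
      · obtain ⟨k, rfl⟩ : ∃ s, k = s + 1 := ⟨k - 1, by omega⟩
        have := h2 i (k + 1) (by omega) k (by omega)
        rw [evS_succ] at this
        rw [show 2 * (k + 1) = 2 * k + 2 by ring]
        linarith
      · have := h2 i k (by omega) k (by omega)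
        rw [odS_succ] at this
        linarith
    · simpa using h3 ∅ (fun _ => 0) (by simp)
    · simpa using h4 ∅ (fun _ => 0) (by simp)
    · intro P κ hκ
      have := h3 P κ (fun p hp => by have := hκ p hp; omega)
      rw [Finset.sum_sub_distrib] at this
      linarith
    · intro P κ hκ
      have := h4 P (fun p => κ p - 2) (fun p hp => by have := hκ p hp; omega)
      have e : ∑ p ∈ P, ((odS a p (ℓ p) - evS a p (ℓ p - 1)) -
          (odS a p (κ p - 2 + 1) - evS a p (κ p - 2))) =
          ∑ p ∈ P, ∑ i ∈ Finset.Icc (κ p) (ℓ p), a p (2 * i - 1) -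
          ∑ p ∈ P, ∑ i ∈ Finset.Icc (κ p - 1) (ℓ p - 1), a p (2 * i) := by
        rw [← Finset.sum_sub_distrib]
        refine Finset.sum_congr rfl fun p hp => ?_
        obtain ⟨s, hs⟩ : ∃ s, κ p = s + 2 := ⟨κ p - 2, by have := hκ p hp; omega⟩
        have hk := (hκ p hp).2
        rw [hs]
        rw [show s + 2 - 1 = s + 1 by omega, show s + 2 - 2 = s by omega,
          evS_diff a p s _ (by omega), odS_diff a p (s + 1) _ (by omega)]
        ring
      try dsimp only at this
      rw [e] at this
      linarith
    · intro p
      have := hℓ p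
      have := h2 p 0 (by omega) (ℓ p - 1) (by omega)
      rw [show ℓ p - 1 + 1 = ℓ p by omega, evS_zero, odS_zero] at this
      linarith
    · intro p f hf1 hf2
      have := h2 p f (by omega) (ℓ p - 1) (by omega)
      rw [show ℓ p - 1 + 1 = ℓ p by omega] at this
      linarith
    · intro p k hk1 hk2
      obtain ⟨s, rfl⟩ : ∃ s, k = s + 2 := ⟨k - 2, by omega⟩
      have := h2 p 0 (by omega) s (by omega)
      have e := evS_diff' a p s (ℓ p - 1) (by omega)
      rw [show ℓ p - 1 + 1 = ℓ p by omega] at e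
      rw [e, odS_diff a p (s + 1) _ (by omega)]
      rw [evS_zero, odS_zero] at this
      linarith
    · intro p f k hf1 hf2 hk2
      obtain ⟨s, rfl⟩ : ∃ s, k = s + 2 := ⟨k - 2, by omega⟩
      have := h2 p f (by omega) s (by omega)
      have e := evS_diff' a p s (ℓ p - 1) (by omega)
      rw [show ℓ p - 1 + 1 = ℓ p by omega] at e
      rw [e, odS_diff a p (s + 1) _ (by omega)]
      linarith
    · intro p f k hf1 hf2 hk
      obtain ⟨s, rfl⟩ : ∃ s, f = s + 2 := ⟨f - 2, by omega⟩
      have := h2 p k (by omega) s (by omega)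
      rw [show s + 2 - 1 = s + 1 by omega,
          evS_diff a p s _ (by omega), odS_diff a p (s + 1) _ (by omega)]
      linarith
  · rintro ⟨c1, c2, ⟨c3, c3'⟩, c4, c5, c6, c7, c8, c9, c10⟩
    have h1 : b₁ + b₂ = ∑ i, (odS a i (ℓ i) - evS a i (ℓ i - 1)) := by
      rw [Finset.sum_sub_distrib]
      linarith
    refine ⟨h1, ?_, ?_, ?_⟩
    · intro p k hk k' hk'
      rcases lt_trichotomy k k' with hlt | rfl | hgt
      · have e : k' + 2 ≤ ℓ p → ∑ i ∈ Finset.Icc (k' + 2) (ℓ p), a p (2 * i - 2) =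
            evS a p (ℓ p - 1) - evS a p k' := by
          intro h
          have e := evS_diff' a p k' (ℓ p - 1) (by omega)
          rwa [show ℓ p - 1 + 1 = ℓ p by omega] at e
        by_cases hk0 : k = 0
        · subst hk0
          rw [evS_zero, odS_zero]
          by_cases hl : k' + 1 = ℓ p
          · have := c6 p
            rw [hl, show k' = ℓ p - 1 by omega]
            linarith
          · have := c8 p (k' + 2) (by omega) (by omega)
            rw [e (by omega), odS_diff a p (k' + 1) _ (by omega)] at this
            linarith
        · by_cases hl : k' + 1 = ℓ p
          · have := c7 p k (by omega) (by omega)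
            rw [hl, show k' = ℓ p - 1 by omega]
            linarith
          · have := c9 p k (k' + 2) (by omega) (by omega) (by omega)
            rw [e (by omega), odS_diff a p (k' + 1) _ (by omega)] at this
            linarith
      · have := c2 p (2 * k + 1) (by omega) (by omega)
        rw [odS_succ]
        linarith
      · by_cases hk1 : k = k' + 1
        · subst hk1
          have := c2 p (2 * k' + 2) (by omega) (by omega)
          rw [evS_succ]
          linarith
        · have := c10 p (k' + 2) k (by omega) (by omega) (by omega)
          rw [show k' + 2 - 1 = k' + 1 by omega,
            evS_diff a p k' _ (by omega), odS_diff a p (k' + 1) _ (by omega)] at this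
          linarith
    · intro P κ hκ
      have := c4 P κ (fun p hp => by have := hκ p hp; omega)
      rw [Finset.sum_sub_distrib]
      linarith
    · refine (h4iff h1).2 (hs4.2 ?_)
      intro P κ hκ
      have hκ' : ∀ p ∈ P, κ p + 2 ≤ ℓ p := fun p hp => by
        have := hκ p hp; omega
      have := c5 P (fun p => κ p + 2) (fun p hp => ⟨by omega, hκ' p hp⟩)
      have e : ∑ p ∈ P, ((odS a p (ℓ p) - evS a p (ℓ p - 1)) -
          (odS a p (κ p + 1) - evS a p (κ p))) =
          ∑ p ∈ P, ∑ i ∈ Finset.Icc (κ p + 2) (ℓ p), a p (2 * i - 1) -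
          ∑ p ∈ P, ∑ i ∈ Finset.Icc (κ p + 2 - 1) (ℓ p - 1), a p (2 * i) := by
        rw [← Finset.sum_sub_distrib]
        refine Finset.sum_congr rfl fun p hp => ?_
        have hk := hκ' p hp
        rw [show κ p + 2 - 1 = κ p + 1 by omega,
          evS_diff a p (κ p) _ (by omega), odS_diff a p (κ p + 1) _ (by omega)]
        ring
      try dsimp only at this ⊢
      rw [e]
      linarith

end Paper
end
end

section
/- Let K be a field, m ≥ 1, and let R be the polynomial ring over K in the variables e_{i,1}, e_{i,2} (1 ≤ i ≤ m−1), f_1, f_2, f_3, g_1, g_2, g_3, w. Let I be the monomial ideal of R generated by the set M = {e_{i,1}e_{j,2} : 1 ≤ i < j ≤ m−1} ∪ {g_1 f_2 e_{i,1} : 1 ≤ i ≤ m−1} ∪ {f_1 f_2 g_1 g_2} ∪ {g_2 f_1 e_{i,2} : 1 ≤ i ≤ m−1}. Then the projective dimension of R/I as an R-module equals m. -/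
open CategoryTheory MvPolynomial Finset
open scoped Classical

noncomputable section

namespace Paper

/-- Variables of the polynomial ring for the two-ear graph: `Sum.inl (i, 0) = e_{i+1,1}`,
`Sum.inl (i, 1) = e_{i+1,2}`, and `Sum.inr 0, …, Sum.inr 6` are `f₁, f₂, f₃, g₁, g₂, g₃, w`. -/
abbrev TEVar (m : ℕ) : Type := (Fin (m - 1) × Fin 2) ⊕ Fin 7

/-- The set of minimal generators of `in_<(I_{G_m})`:
`e_{i,1}e_{j,2}` for `i < j`, `g₁f₂e_{i,1}`, `f₁f₂g₁g₂` and `g₂f₁e_{i,2}`. -/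
def teGens (K : Type*) [Field K] (m : ℕ) : Set (MvPolynomial (TEVar m) K) :=
  {f | (∃ i j : Fin (m - 1), i < j ∧ f = X (Sum.inl (i, 0)) * X (Sum.inl (j, 1))) ∨
    (∃ i : Fin (m - 1), f = X (Sum.inr 3) * X (Sum.inr 1) * X (Sum.inl (i, 0))) ∨
    f = X (Sum.inr 0) * X (Sum.inr 1) * X (Sum.inr 3) * X (Sum.inr 4) ∨
    (∃ i : Fin (m - 1), f = X (Sum.inr 4) * X (Sum.inr 0) * X (Sum.inl (i, 1)))}


section Aux

open CategoryTheory Limits Abelian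

universe v u

theorem hpd_of_res {C : Type u} [Category.{v} C] [Abelian C] {X : C} (P : ProjectiveResolution X) (k : ℕ)
    (h : ∀ i, k < i → IsZero (P.complex.X i)) : HasProjectiveDimensionLT X (k+1) := by
  let := HasExt.standard C
  rw [hasProjectiveDimensionLT_iff]
  intro i hi Y e
  obtain ⟨f, hf, rfl⟩ := P.extMk_surjective e (i+1) rfl
  obtain rfl : f = 0 := (h i (by omega)).eq_of_src _ _
  simp

theorem res_splice {C : Type u} [Category.{v} C] [Abelian C] {S : ShortComplex C} (hS : S.ShortExact)
    (hP : Projective S.X₂) (Q : ProjectiveResolution S.X₁) (k : ℕ)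
    (h : ∀ i, k < i → IsZero (Q.complex.X i)) :
    ∃ P : ProjectiveResolution S.X₃, ∀ i, k + 1 < i → IsZero (P.complex.X i) := by
  have := hS.mono_f
  have := hS.epi_g
  obtain ⟨ρ, hρ0, hρe, hρx⟩ : ∃ ρ : Q.complex.X 0 ⟶ S.X₁, ∃ h : Q.complex.d 1 0 ≫ ρ = 0, Epi ρ ∧
      (ShortComplex.mk _ _ h).Exact :=
    ⟨Q.π.f 0, Q.complex_d_comp_π_f_zero, inferInstanceAs (Epi (Q.π.f 0)), Q.exact₀⟩
  let K := ChainComplex.augment Q.complex (ρ ≫ S.f) (by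
    rw [← Category.assoc, hρ0, zero_comp])
  have hK : ∀ n, Projective (K.X n) := by
    rintro (_ | n)
    · exact hP
    · exact Q.projective n
  refine ⟨⟨K, hK, (ChainComplex.toSingle₀Equiv _ _).symm ⟨S.g, ?_⟩, ⟨fun n => ?_⟩⟩, ?_⟩
  · change (ρ ≫ S.f) ≫ S.g = 0
    simp
  · match n with
    | 0 =>
      rw [ChainComplex.quasiIsoAt₀_iff, ShortComplex.quasiIso_iff_of_zeros']
      rotate_left
      · rfl
      · rfl
      · rfl
      have : (ShortComplex.mk (ρ ≫ S.f) S.g (by simp)).Exact ∧ Epi S.g := by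
        refine ⟨?_, inferInstance⟩
        let α : ShortComplex.mk (ρ ≫ S.f) S.g (by simp) ⟶ S :=
         { τ₁ := ρ
           τ₂ := 𝟙 _
           τ₃ := 𝟙 _ }
        have : Epi α.τ₁ := hρe
        have : IsIso α.τ₂ := by dsimp [α]; infer_instance
        have : Mono α.τ₃ := by dsimp [α]; infer_instance
        rw [ShortComplex.exact_iff_of_epi_of_isIso_of_mono α]
        exact hS.exact
      refine (ShortComplex.exact_and_epi_g_iff_of_iso ?_).2 this
      refine ShortComplex.isoMk (Iso.refl _) (Iso.refl _) (Iso.refl _)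
          ?_ ?_
      · change 𝟙 _ ≫ ρ ≫ S.f = (ρ ≫ S.f) ≫ 𝟙 _
        simp
      · change 𝟙 _ ≫ S.g = _ ≫ 𝟙 _
        simp only [Category.id_comp]
        erw [Category.comp_id]
        exact (ChainComplex.toSingle₀Equiv_symm_apply_f_zero (C := K) S.g _).symm
    | 1 =>
      rw [quasiIsoAt_iff_exactAt']
      swap
      · apply ChainComplex.exactAt_succ_single_obj
      rw [HomologicalComplex.exactAt_iff' _ 2 1 0 (by simp) (by simp)]
      let α : ShortComplex.mk (Q.complex.d 1 0) ρ hρ0 ⟶ K.sc' 2 1 0 :=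
        { τ₁ := 𝟙 (Q.complex.X 1)
          τ₂ := 𝟙 (Q.complex.X 0)
          τ₃ := S.f
          comm₁₂ := by 
            change 𝟙 _ ≫ Q.complex.d 1 0 = Q.complex.d 1 0 ≫ 𝟙 _
            simp
          comm₂₃ := by
            change 𝟙 _ ≫ ρ ≫ S.f = ρ ≫ S.f
            simp }
      have : Epi α.τ₁ := by dsimp [α]; exact inferInstanceAs (Epi (𝟙 (Q.complex.X 1)))
      have : IsIso α.τ₂ := by dsimp [α]; exact inferInstanceAs (IsIso (𝟙 (Q.complex.X 0)))
      have : Mono α.τ₃ := hS.mono_f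
      rw [← ShortComplex.exact_iff_of_epi_of_isIso_of_mono α]
      exact hρx
    | n+2 =>
      rw [quasiIsoAt_iff_exactAt']
      swap
      · apply ChainComplex.exactAt_succ_single_obj
      rw [HomologicalComplex.exactAt_iff' _ (n+3) (n+2) (n+1) (by simp) (by simp)]
      exact Q.exact_succ n
  · rintro (_ | i) hi
    · omega
    · exact h i (by omega)

theorem res_of_hpd {C : Type u} [Category.{v} C] [Abelian C] [EnoughProjectives C] (n : ℕ) (X : C)
    (h : HasProjectiveDimensionLE X n) : 
    ∃ P : ProjectiveResolution X, ∀ i, n < i → IsZero (P.complex.X i) := by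
  induction n generalizing X with
  | zero =>
    have : Projective X := projective_iff_hasProjectiveDimensionLE_zero X |>.2 h
    refine ⟨ProjectiveResolution.self X, fun i hi => ?_⟩
    exact HomologicalComplex.isZero_single_obj_X _ _ _ _ (by omega)
  | succ n ih =>
    rcases EnoughProjectives.presentation X with ⟨⟨P, f⟩⟩
    let T := ShortComplex.mk (kernel.ι f) f (kernel.condition f)
    have T_exact : T.ShortExact := { exact := ShortComplex.exact_kernel f }
    have := (T_exact.hasProjectiveDimensionLT_X₃_iff n ‹_›).mp h
    obtain ⟨Q, hQ⟩ := ih (kernel f) this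
    exact res_splice T_exact ‹_› Q n hQ


/-- `LT`-bound of the projective dimension of a cyclic module. -/
abbrev QuotPdLT {R : Type u} [CommRing R] (I : Ideal R) (n : ℕ) : Prop :=
  HasProjectiveDimensionLT (ModuleCat.of R (R ⧸ I)) n

theorem colon_ses {R : Type u} [CommRing R] (J C : Ideal R) (a : R)
    (h : ∀ x, a * x ∈ J ↔ x ∈ C) : ∃ S : ShortComplex (ModuleCat.{u} R), S.ShortExact ∧
      S.X₁ = ModuleCat.of R (R ⧸ C) ∧ S.X₂ = ModuleCat.of R (R ⧸ J) ∧
      S.X₃ = ModuleCat.of R (R ⧸ (J ⊔ Ideal.span {a})) := by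
  let f : (R ⧸ C) →ₗ[R] (R ⧸ J) := Submodule.mapQ C J (LinearMap.mulLeft R a)
    (fun x hx => (h x).2 hx)
  let g : (R ⧸ J) →ₗ[R] (R ⧸ (J ⊔ Ideal.span {a})) := Submodule.factor le_sup_left
  have hex : Function.Exact f g := by
    intro y
    obtain ⟨y, rfl⟩ := Submodule.Quotient.mk_surjective _ y
    have : g (Submodule.Quotient.mk y) = Submodule.Quotient.mk y := rfl
    rw [this, Submodule.Quotient.mk_eq_zero, Submodule.mem_sup]
    constructor
    · rintro ⟨z, hz, w, hw, rfl⟩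
      obtain ⟨c, rfl⟩ := Ideal.mem_span_singleton.1 hw
      refine ⟨Submodule.Quotient.mk c, ?_⟩
      change (Submodule.Quotient.mk (a * c) : R ⧸ J) = _
      rw [Submodule.Quotient.eq]
      simpa using hz
    · rintro ⟨x, hx⟩
      obtain ⟨x, rfl⟩ := Submodule.Quotient.mk_surjective _ x
      change (Submodule.Quotient.mk (a * x) : R ⧸ J) = _ at hx
      rw [eq_comm, Submodule.Quotient.eq] at hx
      exact ⟨y - a * x, hx, a * x, Ideal.mem_span_singleton.2 ⟨x, rfl⟩, by ring⟩
  have hinj : Function.Injective f := by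
    rw [← LinearMap.ker_eq_bot, LinearMap.ker_eq_bot']
    intro x hx
    obtain ⟨x, rfl⟩ := Submodule.Quotient.mk_surjective _ x
    change (Submodule.Quotient.mk (a * x) : R ⧸ J) = 0 at hx
    rw [Submodule.Quotient.mk_eq_zero] at hx ⊢
    exact (h x).1 hx
  have hsurj : Function.Surjective g := Submodule.factor_surjective _
  refine ⟨ShortComplex.mk (ModuleCat.ofHom f) (ModuleCat.ofHom g) ?_, ?_, rfl, rfl, rfl⟩
  · apply ModuleCat.hom_ext
    apply LinearMap.ext
    intro x
    exact hex.apply_apply_eq_zero x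
  · exact ModuleCat.shortComplex_shortExact _ hex hinj hsurj

theorem pd_colon {R : Type u} [CommRing R] (J C : Ideal R) (a : R)
    (h : ∀ x, a * x ∈ J ↔ x ∈ C) (n : ℕ) (h1 : QuotPdLT C n)
    (h3 : QuotPdLT (J ⊔ Ideal.span {a}) n) : QuotPdLT J n := by
  obtain ⟨S, hS, e1, e2, e3⟩ := colon_ses J C a h
  unfold QuotPdLT at *
  rw [← e1] at h1
  rw [← e3] at h3
  rw [← e2]
  exact hS.hasProjectiveDimensionLT_X₂ n h1 h3

theorem pd_reg {R : Type u} [CommRing R] (J : Ideal R) (a : R)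
    (h : ∀ x, a * x ∈ J → x ∈ J) (n : ℕ) (h1 : QuotPdLT J n) :
    QuotPdLT (J ⊔ Ideal.span {a}) (n + 1) := by
  obtain ⟨S, hS, e1, e2, e3⟩ := colon_ses J J a (fun x => ⟨h x, fun hx => J.mul_mem_left _ hx⟩)
  unfold QuotPdLT at *
  have h2 : HasProjectiveDimensionLT (ModuleCat.of R (R ⧸ J)) (n+1) :=
    hasProjectiveDimensionLT_of_ge _ n (n+1) (by omega)
  rw [← e1] at h1
  rw [← e2] at h2
  rw [← e3]
  exact hS.hasProjectiveDimensionLT_X₃ n h1 h2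

theorem pd_bot {R : Type u} [CommRing R] (J : Ideal R) (hJ : J = ⊥) : QuotPdLT J 1 := by
  subst hJ
  unfold QuotPdLT
  rw [← projective_iff_hasProjectiveDimensionLT_one, ← IsProjective.iff_projective]
  exact Module.Projective.of_equiv (Submodule.quotEquivOfEqBot (⊥ : Ideal R) rfl).symm

/-- tail of the sequence `b` -/
def tailIdeal {R : Type u} [CommRing R] (b : ℕ → R) (m k : ℕ) : Ideal R :=
  Ideal.span {x | ∃ j, k ≤ j ∧ j < m ∧ x = b j}

/-- staircase ideal -/
def stairIdeal {R : Type u} [CommRing R] (a b : ℕ → R) (m k : ℕ) : Ideal R :=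
  Ideal.span {x | ∃ i j, k ≤ i ∧ i ≤ j ∧ j < m ∧ x = a i * b j}

theorem pd_tail {R : Type u} [CommRing R] (b : ℕ → R) (m : ℕ)
    (hb : ∀ k < m, ∀ x, b k * x ∈ tailIdeal b m (k+1) → x ∈ tailIdeal b m (k+1)) (d k : ℕ)
    (hk : k + d = m) : QuotPdLT (tailIdeal b m k) (d + 1) := by
  induction d generalizing k with
  | zero =>
    apply pd_bot
    rw [tailIdeal, Ideal.span_eq_bot]
    rintro x ⟨j, h1, h2, -⟩
    omega
  | succ d ih =>
    have : tailIdeal b m k = tailIdeal b m (k+1) ⊔ Ideal.span {b k} := by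
      rw [tailIdeal, tailIdeal, ← Ideal.span_union]
      congr 1
      ext x
      constructor
      · rintro ⟨j, h1, h2, rfl⟩
        rcases h1.eq_or_lt with rfl | h
        · right; rfl
        · left; exact ⟨j, h, h2, rfl⟩
      · rintro (⟨j, h1, h2, rfl⟩ | rfl)
        · exact ⟨j, by omega, h2, rfl⟩
        · exact ⟨k, le_rfl, by omega, rfl⟩
    rw [this]
    exact pd_reg _ _ (hb k (by omega)) _ (ih (k+1) (by omega))

theorem pd_stair {R : Type u} [CommRing R] (a b : ℕ → R) (m : ℕ)
    (hb : ∀ k < m, ∀ x, b k * x ∈ tailIdeal b m (k+1) → x ∈ tailIdeal b m (k+1)) 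
    (hab : ∀ k < m, ∀ x, a k * x ∈ tailIdeal b m k → x ∈ tailIdeal b m k) 
    (haI : ∀ k < m, ∀ x, a k * x ∈ stairIdeal a b m (k+1) → x ∈ stairIdeal a b m (k+1)) 
    (d k : ℕ)
    (hk : k + d = m) : QuotPdLT (stairIdeal a b m k) (d + 1) := by
  induction d generalizing k with
  | zero =>
    apply pd_bot
    rw [stairIdeal, Ideal.span_eq_bot]
    rintro x ⟨i, j, h1, h2, h3, -⟩
    omega
  | succ d ih =>
    apply pd_colon _ (tailIdeal b m k) (a k)
    · intro x
      constructor
      · intro hx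
        apply hab k (by omega)
        refine Ideal.span_le.2 ?_ hx
        rintro _ ⟨i, j, h1, h2, h3, rfl⟩
        exact Ideal.mul_mem_left _ _ (Ideal.subset_span ⟨j, by omega, h3, rfl⟩)
      · intro hx
        have : tailIdeal b m k ≤ Submodule.comap (LinearMap.mulLeft R (a k)) (stairIdeal a b m k) := by
          apply Ideal.span_le.2
          rintro _ ⟨j, h1, h2, rfl⟩
          exact Ideal.subset_span ⟨k, j, le_rfl, h1, h2, rfl⟩
        exact this hx
    · exact pd_tail b m hb (d+1) k hk
    · have : stairIdeal a b m k ⊔ Ideal.span {a k} = stairIdeal a b m (k+1) ⊔ Ideal.span {a k} := by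
        apply le_antisymm
        · refine sup_le (Ideal.span_le.2 ?_) le_sup_right
          rintro _ ⟨i, j, h1, h2, h3, rfl⟩
          rcases h1.eq_or_lt with rfl | h
          · exact Ideal.mul_mem_right _ _ (Ideal.mem_sup_right (Ideal.subset_span rfl))
          · exact Ideal.mem_sup_left (Ideal.subset_span ⟨i, j, h, h2, h3, rfl⟩)
        · refine sup_le_sup_right (Ideal.span_mono ?_) _
          rintro _ ⟨i, j, h1, h2, h3, rfl⟩
          exact ⟨i, j, by omega, h2, h3, rfl⟩
      rw [this]
      exact pd_reg _ _ (haI k (by omega)) _ (ih (k+1) (by omega))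

theorem loc_pd {R : Type u} [CommRing R] {M : ModuleCat.{u} R} (S : Submonoid R) {N : Type u}
    [AddCommGroup N] [Module R N] [Module (Localization S) N]
    [IsScalarTower R (Localization S) N] (φ : M →ₗ[R] N) [IsLocalizedModule S φ] :
    projectiveDimension (M.localizedModule S) =
      projectiveDimension (ModuleCat.of (Localization S) N) := by
  let e1 := IsLocalizedModule.linearEquiv S (M.localizedModuleMkLinearMap S) φ
  let e2 := LinearEquiv.extendScalarsOfIsLocalization S (Localization S) e1
  exact projectiveDimension_eq_of_iso (LinearEquiv.toModuleIso e2)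

open RingTheory.Sequence in
theorem lower_stair {R : Type u} [CommRing R] [IsNoetherianRing R] (a b : ℕ → R) (m : ℕ)
    (ha : ∀ k < m, ∀ x, a k * x ∈ Ideal.span {x | ∃ j, j < k ∧ x = a j} →
      x ∈ Ideal.span {x | ∃ j, j < k ∧ x = a j})
    (P : Ideal R) [P.IsPrime] (haP : ∀ i < m, a i ∈ P) (hbP : ∀ j < m, b j ∉ P) :
    ¬ QuotPdLT (stairIdeal a b m 0) m := by
  intro hpd
  let A := Localization P.primeCompl
  let rs := (List.range m).map a
  have hof : ∀ k, Ideal.ofList ((List.range k).map a) = Ideal.span {x | ∃ j, j < k ∧ x = a j} := by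
    intro k
    rw [Ideal.ofList]
    congr 1
    ext x
    simp [eq_comm]
  have hreg : IsWeaklyRegular R rs := by
    rw [isWeaklyRegular_iff]
    intro i hi
    simp only [rs, List.length_map, List.length_range] at hi
    have e1 : rs.take i = (List.range i).map a := by
      simp [rs, ← List.map_take, List.take_range, min_eq_left hi.le]
    have e2 : Ideal.ofList (rs.take i) • (⊤ : Submodule R R) =
        Ideal.span {x | ∃ j, j < i ∧ x = a j} := by
      rw [e1, hof]; simp
    rw [e2]
    have e3 : rs[i] = a i := by simp [rs]
    rw [e3, isSMulRegular_iff_right_eq_zero_of_smul]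
    intro x hx
    obtain ⟨x, rfl⟩ := Submodule.Quotient.mk_surjective _ x
    rw [← Submodule.Quotient.mk_smul, Submodule.Quotient.mk_eq_zero] at hx
    rw [Submodule.Quotient.mk_eq_zero]
    exact ha i hi x hx
  have hregA := hreg.of_isLocalization A P.primeCompl
  have hmem : ∀ r ∈ rs.map (algebraMap R A), r ∈ IsLocalRing.maximalIdeal A := by
    intro r hr
    simp only [rs, List.map_map, List.mem_map, List.mem_range] at hr
    obtain ⟨i, hi, rfl⟩ := hr
    exact (IsLocalization.AtPrime.to_map_mem_maximal_iff A P _).2 (haP i hi)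
  have hlen := ModuleCat.projectiveDimension_quotient_eq_add_length_of_isWeaklyRegular
    (ModuleCat.of A A) _ hregA hmem
  have h0 : projectiveDimension (ModuleCat.of A A) = 0 :=
    ModuleCat.projectiveDimension_eq_zero_of_projective _
  rw [h0] at hlen
  simp only [rs, List.length_map, List.length_range, zero_add] at hlen
  have hle := ModuleCat.projectiveDimension_le_projectiveDimension_of_isLocalizedModule
    P.primeCompl (ModuleCat.of R (R ⧸ stairIdeal a b m 0))
  have hideal : (stairIdeal a b m 0).map (algebraMap R A) =
      Ideal.ofList (((List.range m).map a).map (algebraMap R A)) := by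
    rw [← Ideal.map_ofList, hof]
    apply le_antisymm
    · apply Ideal.map_mono
      apply Ideal.span_le.2
      rintro _ ⟨i, j, h1, h2, h3, rfl⟩
      exact Ideal.mul_mem_right _ _ (Ideal.subset_span ⟨i, by omega, rfl⟩)
    · rw [Ideal.map_le_iff_le_comap]
      apply Ideal.span_le.2
      rintro _ ⟨i, hi, rfl⟩
      change algebraMap R A (a i) ∈ (stairIdeal a b m 0).map (algebraMap R A)
      have hu : IsUnit (algebraMap R A (b i)) :=
        IsLocalization.map_units A (⟨b i, hbP i hi⟩ : P.primeCompl)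
      rw [← Ideal.mul_unit_mem_iff_mem _ hu, ← map_mul]
      exact Ideal.mem_map_of_mem _ (Ideal.subset_span ⟨i, i, by omega, le_rfl, hi, rfl⟩)
  have heq : (stairIdeal a b m 0).localized' A P.primeCompl (Algebra.linearMap R A) =
     Ideal.ofList (((List.range m).map a).map (algebraMap R A)) • (⊤ : Submodule A A) := by
    rw [← hideal]
    simp [Ideal.localized'_eq_map]
  have he : projectiveDimension
      ((ModuleCat.of R (R ⧸ stairIdeal a b m 0)).localizedModule P.primeCompl) = m := by
    rw [← hlen]
    rw [loc_pd (M := ModuleCat.of R (R ⧸ stairIdeal a b m 0)) P.primeCompl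
      ((stairIdeal a b m 0).toLocalizedQuotient' A P.primeCompl (Algebra.linearMap R A))]
    exact projectiveDimension_eq_of_iso
      (LinearEquiv.toModuleIso (Submodule.quotEquivOfEq _ _ heq))
  rw [he] at hle
  exact absurd (projectiveDimension_lt_iff.2 hpd) (not_lt.2 hle)

end Aux


def tea (K : Type*) [Field K] (m i : ℕ) : MvPolynomial (TEVar m) K :=
  if i = 0 then X (Sum.inr 4) * X (Sum.inr 0) else
    if h : i - 1 < m - 1 then X (Sum.inl (⟨i - 1, h⟩, 0)) else 0

def teb (K : Type*) [Field K] (m j : ℕ) : MvPolynomial (TEVar m) K :=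
  if h : j < m - 1 then X (Sum.inl (⟨j, h⟩, 1)) else X (Sum.inr 3) * X (Sum.inr 1)

/-- the class of a variable -/
def tec (m : ℕ) : TEVar m → Bool × ℕ
  | Sum.inl (i, e) => if e = 0 then (true, i + 1) else (false, i)
  | Sum.inr r => if r = 4 ∨ r = 0 then (true, 0) else (false, m - 1)

def IsCls (K : Type*) [Field K] (m : ℕ) (q : Bool × ℕ) (t : MvPolynomial (TEVar m) K) : Prop :=
  ∃ s s', tec m s = q ∧ tec m s' = q ∧ (t = X s ∨ t = X s * X s')

def AvoidsCls (K : Type*) [Field K] (m : ℕ) (q : Bool × ℕ) (t : MvPolynomial (TEVar m) K) : Prop :=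
  ∃ g, t = monomial g 1 ∧ ∀ s, tec m s = q → g s = 0

theorem X_reg (K : Type*) [Field K] {σ : Type*} (s : σ) (T : Set (MvPolynomial σ K))
    (hT : ∀ t ∈ T, ∃ g : σ →₀ ℕ, t = monomial g 1 ∧ g s = 0) (x : MvPolynomial σ K)
    (hx : X s * x ∈ Ideal.span T) : x ∈ Ideal.span T := by
  have : T = (fun g => monomial g (1 : K)) '' {g : σ →₀ ℕ | monomial g (1 : K) ∈ T ∧ g s = 0} := by
    ext t
    constructor
    · intro ht
      obtain ⟨g, rfl, hg⟩ := hT t ht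
      exact ⟨g, ⟨ht, hg⟩, rfl⟩
    · rintro ⟨g, ⟨h, -⟩, rfl⟩
      exact h
  rw [this] at hx ⊢
  rw [mem_ideal_span_monomial_image] at hx ⊢
  intro y hy
  obtain ⟨g, hg, hle⟩ := hx (Finsupp.single s 1 + y) (by
    rw [mem_support_iff] at hy ⊢
    rwa [coeff_X_mul])
  refine ⟨g, hg, fun r => ?_⟩
  by_cases h : r = s
  · subst h
    rw [hg.2]
    exact Nat.zero_le _
  · have := hle r
    simpa [Finsupp.single_apply, Ne.symm h] using this

theorem cls_reg (K : Type*) [Field K] (m : ℕ) (q : Bool × ℕ) (t : MvPolynomial (TEVar m) K)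
    (ht : IsCls K m q t) (T : Set (MvPolynomial (TEVar m) K)) (hT : ∀ u ∈ T, AvoidsCls K m q u)
    (x : MvPolynomial (TEVar m) K)
    (hx : t * x ∈ Ideal.span T) : x ∈ Ideal.span T := by
  obtain ⟨s, s', h1, h2, h⟩ := ht
  have key : ∀ s, tec m s = q → ∀ y, X s * y ∈ Ideal.span T → y ∈ Ideal.span T := by
    intro s hs y
    apply X_reg
    intro u hu
    obtain ⟨g, hg, hg'⟩ := hT u hu
    exact ⟨g, hg, hg' s hs⟩
  rcases h with rfl | rfl
  · exact key s h1 _ hx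
  · rw [mul_assoc] at hx
    exact key s' h2 _ (key s h1 _ hx)

theorem avoids_X (K : Type*) [Field K] (m : ℕ) (q : Bool × ℕ) (s : TEVar m) (h : tec m s ≠ q) :
    AvoidsCls K m q (X s) := by
  refine ⟨Finsupp.single s 1, rfl, fun r hr => ?_⟩
  rw [Finsupp.single_apply, if_neg]
  rintro rfl
  exact h hr

theorem avoids_mul (K : Type*) [Field K] (m : ℕ) (q : Bool × ℕ) (t u : MvPolynomial (TEVar m) K)
    (ht : AvoidsCls K m q t) (hu : AvoidsCls K m q u) :
    AvoidsCls K m q (t * u) := by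
  obtain ⟨g, rfl, hg⟩ := ht
  obtain ⟨g', rfl, hg'⟩ := hu
  refine ⟨g + g', by simp [monomial_mul], fun s hs => by simp [hg s hs, hg' s hs]⟩

theorem avoids_cls (K : Type*) [Field K] (m : ℕ) (q q' : Bool × ℕ) (t : MvPolynomial (TEVar m) K)
    (ht : IsCls K m q' t) (h : q' ≠ q) : AvoidsCls K m q t := by
  obtain ⟨s, s', h1, h2, rfl | rfl⟩ := ht
  · exact avoids_X K m q s (h1 ▸ h)
  · exact avoids_mul _ _ _ _ _ (avoids_X K m q s (h1 ▸ h)) (avoids_X K m q s' (h2 ▸ h))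

theorem cls_a (K : Type*) [Field K] (m i : ℕ) (hi : i < m) : IsCls K m (true, i) (tea K m i) := by
  rcases i with _ | i
  · exact ⟨Sum.inr 4, Sum.inr 0, by simp [tec], by simp [tec], Or.inr (by simp [tea])⟩
  · have h : i < m - 1 := by omega
    exact ⟨Sum.inl (⟨i, h⟩, 0), Sum.inl (⟨i, h⟩, 0), by simp [tec], by simp [tec],
      Or.inl (by simp [tea, h])⟩

theorem cls_b (K : Type*) [Field K] (m j : ℕ) (hj : j < m) : IsCls K m (false, j) (teb K m j) := by
  by_cases h : j < m - 1
  · exact ⟨Sum.inl (⟨j, h⟩, 1), Sum.inl (⟨j, h⟩, 1), by simp [tec], by simp [tec],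
      Or.inl (by simp [teb, h])⟩
  · obtain rfl : j = m - 1 := by omega
    exact ⟨Sum.inr 3, Sum.inr 1, by simp [tec], by simp [tec], Or.inr (by simp [teb])⟩

theorem teGens_span (K : Type*) [Field K] (m : ℕ) (hm : 1 ≤ m) :
    Ideal.span (teGens K m) = stairIdeal (tea K m) (teb K m) m 0 := by
  rw [stairIdeal]
  congr 1
  ext f
  constructor
  · rintro (⟨i, j, hij, rfl⟩ | ⟨i, rfl⟩ | rfl | ⟨i, rfl⟩)
    · refine ⟨i + 1, j, by omega, hij, by omega, ?_⟩
      simp [tea, teb]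
    · refine ⟨i + 1, m - 1, by omega, by omega, by omega, ?_⟩
      simp [tea, teb, mul_comm]
    · refine ⟨0, m - 1, by omega, by omega, by omega, ?_⟩
      simp [tea, teb]
      ring
    · refine ⟨0, i, by omega, by omega, by omega, ?_⟩
      simp [tea, teb]
  · rintro ⟨i, j, -, hij, hj, rfl⟩
    rcases i with _ | i
    · by_cases h : j < m - 1
      · right; right; right
        exact ⟨⟨j, h⟩, by simp [tea, teb, h]⟩
      · right; right; left
        simp [tea, teb, h]
        ring
    · have hi : i < m - 1 := by omega
      by_cases h : j < m - 1
      · left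
        exact ⟨⟨i, hi⟩, ⟨j, h⟩, by rw [Fin.mk_lt_mk]; omega, by simp [tea, teb, h, hi]⟩
      · right; left
        exact ⟨⟨i, hi⟩, by simp [tea, teb, h, hi]; ring⟩

theorem te_upper (K : Type*) [Field K] (m : ℕ) (hm : 1 ≤ m) :
    QuotPdLT (Ideal.span (teGens K m)) (m + 1) := by
  rw [teGens_span K m hm]
  apply pd_stair (tea K m) (teb K m) m _ _ _ m 0 (by omega)
  · intro k hk
    apply cls_reg K m (false, k) _ (cls_b K m k hk)
    rintro _ ⟨j, h1, h2, rfl⟩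
    exact avoids_cls _ _ _ _ _ (cls_b K m j h2) (by simp; omega)
  · intro k hk
    apply cls_reg K m (true, k) _ (cls_a K m k hk)
    rintro _ ⟨j, h1, h2, rfl⟩
    exact avoids_cls _ _ _ _ _ (cls_b K m j h2) (by simp)
  · intro k hk
    apply cls_reg K m (true, k) _ (cls_a K m k hk)
    rintro _ ⟨i, j, h1, h2, h3, rfl⟩
    exact avoids_mul _ _ _ _ _
      (avoids_cls _ _ _ _ _ (cls_a K m i (by omega)) (by simp; omega))
      (avoids_cls _ _ _ _ _ (cls_b K m j h3) (by simp))

/-- kills `g₂` and all `e_{i,1}` -/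
def teEval (K : Type*) [Field K] (m : ℕ) : MvPolynomial (TEVar m) K →ₐ[K] MvPolynomial (TEVar m) K :=
  aeval (fun s => if s = Sum.inr 4 ∨ ∃ i, s = Sum.inl (i, 0) then 0 else X s)

theorem te_lower (K : Type*) [Field K] (m : ℕ) (hm : 1 ≤ m) :
    ¬ QuotPdLT (Ideal.span (teGens K m)) m := by
  rw [teGens_span K m hm]
  have : (RingHom.ker (teEval K m)).IsPrime := RingHom.ker_isPrime _
  apply lower_stair (tea K m) (teb K m) m _ (RingHom.ker (teEval K m))
  · intro i hi
    rw [RingHom.mem_ker]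
    rcases i with _ | i
    · simp [tea, teEval]
    · have h : i < m - 1 := by omega
      simp [tea, teEval, h]
  · intro j hj
    rw [RingHom.mem_ker]
    by_cases h : j < m - 1
    · simp [teb, teEval, h]
    · have h34 : (3 : Fin 7) ≠ 4 := by decide
      have h14 : (1 : Fin 7) ≠ 4 := by decide
      simp [teb, teEval, h, h34, h14]
  · intro k hk
    apply cls_reg K m (true, k) _ (cls_a K m k hk)
    rintro _ ⟨j, h1, rfl⟩
    exact avoids_cls _ _ _ _ _ (cls_a K m j (by omega)) (by simp; omega)

/-- The projective dimension of `R/in_<(I_{G_m})` equals `m`. -/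
theorem statement13 (K : Type*) [Field K] (m : ℕ) (hm : 1 ≤ m) :
    projDim (MvPolynomial (TEVar m) K)
      (ModuleCat.of _ (MvPolynomial (TEVar m) K ⧸ Ideal.span (teGens K m))) = (m : ℕ∞) := by
  apply le_antisymm
  · apply sInf_le
    exact ⟨m, rfl, res_of_hpd m _ (te_upper K m hm)⟩
  · apply le_sInf
    rintro _ ⟨k, rfl, P, hP⟩
    by_contra hlt
    have hlt' : k < m := by exact_mod_cast not_le.1 hlt
    have := hpd_of_res P k hP
    exact te_lower K m hm (hasProjectiveDimensionLT_of_ge _ (k + 1) m hlt')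

end Paper
end
end
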